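/- The derived subgroup [W~, W~] of W~ is a good normal subgroup of W~. -/

import Mathlib

open MvPolynomial

noncomputable section

namespace ReflQuot

variable {k : Type} [Field k]

/-- The action of an invertible matrix `g` on polynomial functions on `k^n`:
the linear form `X i` is sent to `∑ j, (g⁻¹) i j • X j`, so that
`(g • f) (v) = f (g⁻¹ ⬝ v)`. -/
def matAct {n : ℕ} (g : Matrix.GeneralLinearGroup (Fin n) k) :
    MvPolynomial (Fin n) k →ₐ[k] MvPolynomial (Fin n) k :=
  aeval fun i => ∑ j, ((↑(g⁻¹) : Matrix (Fin n) (Fin n) k) i j) • X j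

/-- The algebra endomorphism of `k[X_1,…,X_m]` sending `X i` to `∑ j, M i j • X j`. -/
def polyAct {m : ℕ} (M : Fin m → Fin m → k) :
    MvPolynomial (Fin m) k →ₐ[k] MvPolynomial (Fin m) k :=
  aeval fun i => ∑ j, M i j • X j

/-- A reflection: an automorphism of finite order whose fixed-point subspace is a
hyperplane. -/
def IsReflection {n : ℕ} (M : Matrix (Fin n) (Fin n) k) : Prop :=
  IsOfFinOrder M ∧
    Module.finrank k (LinearMap.ker (Matrix.toLin' M - LinearMap.id)) + 1 = n

/-- A double reflection: finite order, fixed points of codimension 2. -/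
def IsDoubleReflection {n : ℕ} (M : Matrix (Fin n) (Fin n) k) : Prop :=
  IsOfFinOrder M ∧
    Module.finrank k (LinearMap.ker (Matrix.toLin' M - LinearMap.id)) + 2 = n

/-- A reflection group: a group generated by its reflections. -/
def IsReflectionGroup {n : ℕ} (W : Subgroup (Matrix.GeneralLinearGroup (Fin n) k)) : Prop :=
  Subgroup.closure {g | g ∈ W ∧ IsReflection ((g : Matrix (Fin n) (Fin n) k))} = W

/-- The algebra of `G`-invariant polynomials. -/
def invariants {n : ℕ} (G : Subgroup (Matrix.GeneralLinearGroup (Fin n) k)) :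
    Subalgebra k (MvPolynomial (Fin n) k) where
  carrier := {f | ∀ g ∈ G, matAct g f = f}
  mul_mem' := fun {a b} ha hb g hg => by
    rw [map_mul, ha g hg, hb g hg]
  one_mem' := fun g _ => map_one (matAct g)
  add_mem' := fun {a b} ha hb g hg => by
    rw [map_add, ha g hg, hb g hg]
  zero_mem' := fun g _ => map_zero (matAct g)
  algebraMap_mem' := fun r g _ => (matAct g).commutes r

/-- The linear span of products of two positive-degree invariants, i.e. `(B^G_+)^2`. -/
def sqSpan {n : ℕ} (G : Subgroup (Matrix.GeneralLinearGroup (Fin n) k)) :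
    Submodule k (MvPolynomial (Fin n) k) :=
  Submodule.span k {f | ∃ u ∈ invariants G, ∃ v ∈ invariants G,
    constantCoeff u = 0 ∧ constantCoeff v = 0 ∧ f = u * v}

/-- The ideal of positive-degree elements of the polynomial ring. -/
def idealPlus (k : Type) [Field k] (m : ℕ) : Ideal (MvPolynomial (Fin m) k) :=
  Ideal.span (Set.range X)

/-- The ideal `I` of relations between the generators `p i` of the invariant algebra:
the kernel of `k[V] = k[X_1,…,X_m] → B^G`, `X i ↦ p i`. -/
def relIdeal {n m : ℕ} (p : Fin m → MvPolynomial (Fin n) k) :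
    Ideal (MvPolynomial (Fin m) k) :=
  RingHom.ker (aeval p : MvPolynomial (Fin m) k →ₐ[k] MvPolynomial (Fin n) k)

/-- The context: `Wt` is a finite reflection group on `k^n`, `G` a normal subgroup of `Wt`,
`p` a minimal system of homogeneous generators (of degrees `d`) of the invariant algebra
`B^G` whose span is `Wt`-stable (i.e. a graded `W`-equivariant section of
`B^G_+ → B^G_+/(B^G_+)^2`), and `c w` the matrix of the action of `w` on the span of the
`p i`, giving the induced action of `W = Wt/G` on `V = k^m`. -/
structure QuotSetup {n m : ℕ} (Wt G : Subgroup (Matrix.GeneralLinearGroup (Fin n) k))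
    (p : Fin m → MvPolynomial (Fin n) k) (d : Fin m → ℕ)
    (c : ↥Wt → Fin m → Fin m → k) : Prop where
  finite : (Wt : Set (Matrix.GeneralLinearGroup (Fin n) k)).Finite
  reflGroup : IsReflectionGroup Wt
  le : G ≤ Wt
  normal : ∀ w ∈ Wt, ∀ g ∈ G, w * g * w⁻¹ ∈ G
  homog : ∀ i, (p i).IsHomogeneous (d i)
  dpos : ∀ i, 0 < d i
  gen : Algebra.adjoin k (Set.range p) = invariants G
  minimal : ∀ a : Fin m → k, (∑ i, a i • p i) ∈ sqSpan G → a = 0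
  equivar : ∀ (w : ↥Wt) (i), matAct (w : Matrix.GeneralLinearGroup (Fin n) k) (p i)
      = ∑ j, c w i j • p j

/-- `W = Wt/G` acts trivially on the conormal module `I/(A_+ I)`. -/
def TrivialConormal {n m : ℕ} (Wt : Subgroup (Matrix.GeneralLinearGroup (Fin n) k))
    (p : Fin m → MvPolynomial (Fin n) k) (c : ↥Wt → Fin m → Fin m → k) : Prop :=
  ∀ w : ↥Wt, ∀ f ∈ relIdeal p, polyAct (c w) f - f ∈ idealPlus k m * relIdeal p

/-- `G` is of complete intersection: `I` is generated by `dim V - dim Vt = m - n` elements. -/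
def IsCompleteIntersection {n m : ℕ} (p : Fin m → MvPolynomial (Fin n) k) : Prop :=
  ∃ s : Finset (MvPolynomial (Fin m) k), s.card = m - n ∧ Ideal.span (s : Set _) = relIdeal p

/-- `G` is a good normal subgroup of `Wt`. -/
def IsGoodQuot {n m : ℕ} (Wt : Subgroup (Matrix.GeneralLinearGroup (Fin n) k))
    (p : Fin m → MvPolynomial (Fin n) k) (c : ↥Wt → Fin m → Fin m → k) : Prop :=
  IsCompleteIntersection p ∧ TrivialConormal Wt p c


/-- The pointwise stabilizer of a subspace `L` in `GL_n(k)`. -/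
def pointStab {n : ℕ} (L : Submodule k (Fin n → k)) :
    Subgroup (Matrix.GeneralLinearGroup (Fin n) k) where
  carrier := {g | ∀ x ∈ L, Matrix.mulVec (g : Matrix (Fin n) (Fin n) k) x = x}
  one_mem' := fun x _ => Matrix.one_mulVec x
  mul_mem' := fun {a b} ha hb x hx => by
    rw [Units.val_mul, ← Matrix.mulVec_mulVec, hb x hx, ha x hx]
  inv_mem' := fun {a} ha x hx => by
    have h1 : Matrix.mulVec (↑(a⁻¹) : Matrix (Fin n) (Fin n) k)
        (Matrix.mulVec (↑a : Matrix (Fin n) (Fin n) k) x) = x := by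
      rw [Matrix.mulVec_mulVec, ← Units.val_mul, inv_mul_cancel, Units.val_one,
        Matrix.one_mulVec]
    rw [ha x hx] at h1
    exact h1

/-- The set of reflecting hyperplanes of a subgroup `W` of `GL_n(k)`. -/
def reflHyps {n : ℕ} (W : Subgroup (Matrix.GeneralLinearGroup (Fin n) k)) :
    Set (Submodule k (Fin n → k)) :=
  {H | ∃ g ∈ W, IsReflection ((g : Matrix (Fin n) (Fin n) k)) ∧
      H = LinearMap.ker (Matrix.toLin' ((g : Matrix (Fin n) (Fin n) k)) - LinearMap.id)}

/-- The set `A'(Wt)` of reflecting hyperplanes `H` of `Wt` such that `Wt_H ≠ G_H`. -/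
def reflHyps' {n : ℕ} (Wt G : Subgroup (Matrix.GeneralLinearGroup (Fin n) k)) :
    Set (Submodule k (Fin n → k)) :=
  {H | H ∈ reflHyps Wt ∧ ¬ (Wt ⊓ pointStab H ≤ G)}

/-- `Wt_H` and `Wt_{H'}` have the same image in `W = Wt/G`. -/
def imageEq {n : ℕ} (Wt G : Subgroup (Matrix.GeneralLinearGroup (Fin n) k))
    (H H' : Submodule k (Fin n → k)) : Prop :=
  {x | ∃ g ∈ G, ∃ u ∈ Wt ⊓ pointStab H, x = g * u}
    = {x | ∃ g ∈ G, ∃ u ∈ Wt ⊓ pointStab H', x = g * u}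

/-- `e_H = |G_H|`. -/
def eH {n : ℕ} (G : Subgroup (Matrix.GeneralLinearGroup (Fin n) k))
    (H : Submodule k (Fin n → k)) : ℕ :=
  Nat.card ↥(G ⊓ pointStab H)

/-- The map `p : Vt → V`, `x ↦ (p 1 (x), …, p m (x))`. -/
def pMap {n m : ℕ} (p : Fin m → MvPolynomial (Fin n) k) (x : Fin n → k) : Fin m → k :=
  fun i => eval x (p i)

/-- The matrix of the action of (the image in `W` of) `w` on `V = k^m`. -/
def qMat {n m : ℕ} {Wt : Subgroup (Matrix.GeneralLinearGroup (Fin n) k)}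
    (c : ↥Wt → Fin m → Fin m → k) (w : ↥Wt) : Matrix (Fin m) (Fin m) k :=
  Matrix.of (c w⁻¹)

/-- The set of reflecting hyperplanes of `W = Wt/G` acting on `V = k^m`. -/
def reflHypsV {n m : ℕ} {Wt : Subgroup (Matrix.GeneralLinearGroup (Fin n) k)}
    (c : ↥Wt → Fin m → Fin m → k) : Set (Submodule k (Fin m → k)) :=
  {K | ∃ w : ↥Wt, IsReflection (qMat c w) ∧
      K = LinearMap.ker (Matrix.toLin' (qMat c w) - LinearMap.id)}

/-- The underlying matrix of an element of a subgroup of `GL_n(k)`. -/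
def matOf {n : ℕ} {Wt : Subgroup (Matrix.GeneralLinearGroup (Fin n) k)} (w : ↥Wt) :
    Matrix (Fin n) (Fin n) k :=
  ((w : Matrix.GeneralLinearGroup (Fin n) k) : Matrix (Fin n) (Fin n) k)

section Graded

variable {σ τ : Type*}

theorem weightedHomogeneousComponent_mul_of_isWeightedHomogeneous {w : σ → ℕ} {e : ℕ}
    {f : MvPolynomial σ k} (hf : IsWeightedHomogeneous w f e) (g : MvPolynomial σ k) (N : ℕ) :
    weightedHomogeneousComponent w N (f * g)
      = if e ≤ N then f * weightedHomogeneousComponent w (N - e) g else 0 := by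
  classical
  induction g using MvPolynomial.induction_on' with
  | monomial u a =>
    have h1 := isWeightedHomogeneous_monomial w u a rfl
    have h2 := hf.mul h1
    rw [weightedHomogeneousComponent_of_mem h2, weightedHomogeneousComponent_of_mem h1]
    split_ifs <;> first | rfl | omega | simp
  | add a b iha ihb =>
    rw [mul_add, map_add, iha, ihb, map_add]
    split_ifs <;> simp [mul_add]

theorem isWeightedHomogeneous_aeval {w : σ → ℕ} {v : τ → ℕ}
    {p : σ → MvPolynomial τ k} (hp : ∀ i, IsWeightedHomogeneous v (p i) (w i))
    {f : MvPolynomial σ k} {e : ℕ} (hf : IsWeightedHomogeneous w f e) :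
    IsWeightedHomogeneous v (aeval p f) e := by
  induction hf using IsWeightedHomogeneous.induction_on with
  | zero => simpa using isWeightedHomogeneous_zero k v e
  | add a b _ _ iha ihb => simpa using iha.add ihb
  | monomial u r hr =>
    rw [aeval_monomial, algebraMap_eq]
    refine IsWeightedHomogeneous.C_mul ?_ r
    subst hr
    rw [Finsupp.weight_apply]
    exact IsWeightedHomogeneous.prod _ _ _ fun i _ => by simpa using (hp i).pow (u i)

theorem weightedHomogeneousComponent_aeval {w : σ → ℕ} {v : τ → ℕ}
    {p : σ → MvPolynomial τ k} (hp : ∀ i, IsWeightedHomogeneous v (p i) (w i))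
    (f : MvPolynomial σ k) (e : ℕ) :
    weightedHomogeneousComponent v e (aeval p f)
      = aeval p (weightedHomogeneousComponent w e f) := by
  classical
  induction f using MvPolynomial.induction_on' with
  | monomial u a =>
    have h1 := isWeightedHomogeneous_monomial w u a rfl
    have h2 := isWeightedHomogeneous_aeval hp h1
    rw [weightedHomogeneousComponent_of_mem h2, weightedHomogeneousComponent_of_mem h1]
    split_ifs <;> simp
  | add a b iha ihb => simp only [map_add, iha, ihb]

/-- A polynomial satisfies any property closed under finite sums that all of its weighted
homogeneous components have. -/
theorem mem_of_weightedHomogeneousComponent_mem (w : σ → ℕ) {f : MvPolynomial σ k}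
    {M : Type*} [SetLike M (MvPolynomial σ k)] [AddSubmonoidClass M (MvPolynomial σ k)] (S : M)
    (h : ∀ e, weightedHomogeneousComponent w e f ∈ S) : f ∈ S := by
  rw [← sum_weightedHomogeneousComponent w f]
  exact finsum_induction (· ∈ S) (zero_mem S) (fun _ _ hx hy => add_mem hx hy) h

theorem constantCoeff_eq_zero_of_isWeightedHomogeneous {w : σ → ℕ} {f : MvPolynomial σ k} {e : ℕ}
    (hf : IsWeightedHomogeneous w f e) (he : e ≠ 0) : constantCoeff f = 0 := by
  rw [constantCoeff_eq]
  exact hf.coeff_eq_zero 0 (by simpa using he.symm)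

theorem constantCoeff_aeval_of_forall {p : σ → MvPolynomial τ k}
    (hp : ∀ i, constantCoeff (p i) = 0) (f : MvPolynomial σ k) :
    constantCoeff (aeval p f) = constantCoeff f := by
  induction f using MvPolynomial.induction_on with
  | C a => simp
  | add f g hf hg => simp only [map_add, hf, hg]
  | mul_X f i hf => simp [hp]

theorem mem_idealPlus_iff {m : ℕ} (f : MvPolynomial (Fin m) k) :
    f ∈ idealPlus k m ↔ constantCoeff f = 0 := by
  constructor
  · intro h
    have h1 : idealPlus k m ≤ RingHom.ker (constantCoeff (R := k) (σ := Fin m)) := by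
      rw [idealPlus, Ideal.span_le]
      rintro _ ⟨i, rfl⟩
      simp [RingHom.mem_ker]
    exact h1 h
  · intro h
    have key : ∀ g : MvPolynomial (Fin m) k, g - C (constantCoeff g) ∈ idealPlus k m := by
      intro g
      induction g using MvPolynomial.induction_on with
      | C a => simp
      | add f g hf hg =>
        have := add_mem hf hg
        simp only [map_add]
        convert this using 1
        ring
      | mul_X f i hf =>
        simpa [idealPlus] using
          Ideal.mul_mem_left _ f (Ideal.subset_span (Set.mem_range_self (f := X (R := k)) i))
    simpa [h] using key f

/-- The linear coefficient of a polynomial in the variable `i`. -/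
def linCoeff (i : σ) : MvPolynomial σ k →ₗ[k] k :=
  (lcoeff k 0).comp (pderiv i).toLinearMap

theorem linCoeff_mul (i : σ) (f g : MvPolynomial σ k) :
    linCoeff i (f * g) = constantCoeff f * linCoeff i g + constantCoeff g * linCoeff i f := by
  have h : ∀ a : MvPolynomial σ k, lcoeff k 0 a = constantCoeff a := fun _ => rfl
  simp [linCoeff, h, Derivation.leibniz]

theorem linCoeff_C (i : σ) (a : k) : linCoeff i (C a) = 0 := by
  simp [linCoeff]

theorem linCoeff_X [DecidableEq σ] (i j : σ) :
    linCoeff (k := k) i (X j) = if i = j then 1 else 0 := by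
  by_cases h : i = j <;> simp [linCoeff, pderiv_X, h, eq_comm]

theorem linCoeff_aeval [Fintype σ] {p : σ → MvPolynomial τ k}
    (hp : ∀ i, constantCoeff (p i) = 0) (j : τ) (f : MvPolynomial σ k) :
    linCoeff j (aeval p f) = ∑ i, linCoeff i f * linCoeff j (p i) := by
  classical
  induction f using MvPolynomial.induction_on with
  | C a => simp [linCoeff_C]
  | add f g hf hg => simp only [map_add, hf, hg, add_mul, Finset.sum_add_distrib]
  | mul_X f i hf =>
    simp only [map_mul, aeval_X, linCoeff_mul, hp, constantCoeff_X, linCoeff_X,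
      constantCoeff_aeval_of_forall hp]
    simp

end Graded

section Nakayama

variable {m : ℕ}

/-- The `k`-linear quotient map onto `A / A_+ I`. -/
abbrev modPlus (I : Ideal (MvPolynomial (Fin m) k)) :=
  ((idealPlus k m * I).restrictScalars k).mkQ

theorem exists_mem_span_of_finrank_le {d : Fin m → ℕ} (hd : ∀ i, 0 < d i)
    {I : Ideal (MvPolynomial (Fin m) k)}
    (hI : ∀ f ∈ I, ∀ e, weightedHomogeneousComponent d e f ∈ I)
    {E : Set (MvPolynomial (Fin m) k)} (hEI : E ⊆ I)
    (hE : ∀ f ∈ E, ∃ e, IsWeightedHomogeneous d f e)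
    (hsp : ∀ f ∈ I, ∃ g ∈ Submodule.span k E, f - g ∈ idealPlus k m * I) :
    Ideal.span E = I := by
  apply le_antisymm (Ideal.span_le.2 hEI)
  have hEspan : ∀ g ∈ Submodule.span k E, ∀ e,
      weightedHomogeneousComponent d e g ∈ Ideal.span E := by
    intro g hg e
    induction hg using Submodule.span_induction with
    | mem x hx =>
      obtain ⟨e', he'⟩ := hE x hx
      classical
      rw [weightedHomogeneousComponent_of_mem he']
      split_ifs
      · exact Ideal.subset_span hx
      · exact zero_mem _
    | zero => simp
    | add x y _ _ hx hy => rw [map_add]; exact add_mem hx hy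
    | smul a x _ hx => rw [map_smul]; exact Submodule.smul_of_tower_mem _ a hx
  have key : ∀ e, ∀ f ∈ I, IsWeightedHomogeneous d f e → f ∈ Ideal.span E := by
    intro e
    induction e using Nat.strong_induction_on with
    | _ e ih =>
      intro f hf hfe
      obtain ⟨g, hg, hfg⟩ := hsp f hf
      have h0 : ∀ x ∈ idealPlus k m, ∀ b ∈ I,
          weightedHomogeneousComponent d e (x * b) ∈ Ideal.span E := by
        intro x hx
        rw [idealPlus] at hx
        induction hx using Submodule.span_induction with
        | mem x hx =>
          obtain ⟨i, rfl⟩ := hx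
          intro b hb
          rw [weightedHomogeneousComponent_mul_of_isWeightedHomogeneous
            (isWeightedHomogeneous_X k d i)]
          split_ifs with h
          · exact Ideal.mul_mem_left _ _ (ih _ (Nat.sub_lt_self (hd i) h) _ (hI b hb _)
              (weightedHomogeneousComponent_isWeightedHomogeneous _ _))
          · exact zero_mem _
        | zero => simp
        | add x y _ _ hx hy =>
          intro b hb
          rw [add_mul, map_add]
          exact add_mem (hx b hb) (hy b hb)
        | smul a x _ hx =>
          intro b hb
          rw [smul_eq_mul, mul_comm a x, mul_assoc]
          exact hx _ (I.mul_mem_left a hb)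
      have h1 : ∀ x ∈ idealPlus k m * I, weightedHomogeneousComponent d e x ∈ Ideal.span E := by
        intro x hx
        induction hx using Submodule.mul_induction_on' with
        | mem_mul_mem a ha b hb => exact h0 a ha b hb
        | add x _ y _ hx hy => rw [map_add]; exact add_mem hx hy
      have h2 := add_mem (h1 _ hfg) (hEspan g hg e)
      rwa [← map_add, sub_add_cancel, hfe.weightedHomogeneousComponent_same] at h2
  intro f hf
  exact mem_of_weightedHomogeneousComponent_mem d _ fun e =>
    key e _ (hI f hf e) (weightedHomogeneousComponent_isWeightedHomogeneous e f)

theorem exists_finset_span_eq_of_finrank_le {d : Fin m → ℕ} (hd : ∀ i, 0 < d i)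
    {I : Ideal (MvPolynomial (Fin m) k)}
    (hI : ∀ f ∈ I, ∀ e, weightedHomogeneousComponent d e f ∈ I) {r : ℕ}
    [FiniteDimensional k ((I.restrictScalars k).map (modPlus I))]
    (hr : Module.finrank k ((I.restrictScalars k).map (modPlus I)) ≤ r) :
    ∃ s : Finset (MvPolynomial (Fin m) k), s.card ≤ r ∧ Ideal.span (s : Set _) = I := by
  classical
  set E : Set (MvPolynomial (Fin m) k) := {f | f ∈ I ∧ ∃ e, IsWeightedHomogeneous d f e} with hE
  have hspE : Submodule.span k E = I.restrictScalars k := by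
    apply le_antisymm
    · rw [Submodule.span_le]; exact fun f hf => hf.1
    · intro f hf
      exact mem_of_weightedHomogeneousComponent_mem d _ fun e => Submodule.subset_span
        ⟨hI f hf e, e, weightedHomogeneousComponent_isWeightedHomogeneous e f⟩
  obtain ⟨b, hbE, hbspan, hbli⟩ := exists_linearIndependent k (modPlus I '' E)
  rw [← Submodule.map_span, hspE] at hbspan
  have hfd : FiniteDimensional k (Submodule.span k b) := by rw [hbspan]; infer_instance
  have hbfin : b.Finite := by
    have h1 : LinearIndependent k
        (fun x : b => (⟨x, Submodule.subset_span x.2⟩ : Submodule.span k b)) :=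
      LinearIndependent.of_comp (Submodule.span k b).subtype hbli
    exact h1.finite
  have := hbfin.fintype
  have hcard : b.toFinset.card ≤ r := by
    rw [← finrank_span_set_eq_card hbli, hbspan]
    exact hr
  have hch : ∀ x : b, ∃ f ∈ E, modPlus I f = x := fun x => hbE x.2
  choose g hgE hg using hch
  refine ⟨Finset.univ.image g, Finset.card_image_le.trans (by
    rw [Finset.card_univ, ← Set.toFinset_card]; exact hcard), ?_⟩
  rw [Finset.coe_image, Finset.coe_univ, Set.image_univ]
  refine exists_mem_span_of_finrank_le hd hI ?_ ?_ ?_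
  · rintro _ ⟨x, rfl⟩; exact (hgE x).1
  · rintro _ ⟨x, rfl⟩; exact (hgE x).2
  · intro f hf
    have h1 : modPlus I f ∈ (Submodule.span k (Set.range g)).map (modPlus I) := by
      rw [Submodule.map_span, ← Set.range_comp]
      have : (modPlus I ∘ g) = Subtype.val := funext hg
      rw [this, Subtype.range_coe, hbspan]
      exact Submodule.mem_map_of_mem hf
    obtain ⟨g', hg', h2⟩ := h1
    refine ⟨g', hg', ?_⟩
    have h3 : modPlus I (f - g') = 0 := by rw [map_sub, h2, sub_self]
    exact (Submodule.Quotient.mk_eq_zero _).1 h3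

end Nakayama

section Comparison

variable {m : ℕ}

/-- The first-order Taylor expansion of an endomorphism congruent to the identity modulo `I`. -/
theorem sub_aeval_sub_sum_linCoeff_mem {I : Ideal (MvPolynomial (Fin m) k)}
    (hI : I ≤ idealPlus k m) {u : Fin m → MvPolynomial (Fin m) k} (hu : ∀ i, X i - u i ∈ I)
    (g : MvPolynomial (Fin m) k) :
    g - aeval u g - ∑ i, linCoeff i g • (X i - u i) ∈ idealPlus k m * I := by
  have hu0 : ∀ i, constantCoeff (u i) = 0 := fun i => by
    simpa using (mem_idealPlus_iff _).1 (hI (hu i))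
  have hsub : ∀ g : MvPolynomial (Fin m) k, g - aeval u g ∈ I := by
    intro g
    induction g using MvPolynomial.induction_on with
    | C a => simp
    | add f g hf hg =>
      rw [map_add, add_sub_add_comm]
      exact add_mem hf hg
    | mul_X f i hf =>
      have h : f * X i - aeval u (f * X i)
          = X i * (f - aeval u f) + aeval u f * (X i - u i) := by
        rw [map_mul, aeval_X]; ring
      rw [h]
      exact add_mem (I.mul_mem_left _ hf) (I.mul_mem_left _ (hu i))
  induction g using MvPolynomial.induction_on with
  | C a => simp [linCoeff_C]
  | add f g hf hg =>
    convert add_mem hf hg using 1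
    simp only [map_add, add_smul, Finset.sum_add_distrib]
    ring
  | mul_X f i hf =>
    have h : f * X i - aeval u (f * X i) - ∑ j, linCoeff j (f * X i) • (X j - u j)
        = X i * (f - aeval u f) + (aeval u f - C (constantCoeff f)) * (X i - u i) := by
      have h1 : ∑ j, linCoeff j (f * X i) • (X j - u j) = C (constantCoeff f) * (X i - u i) := by
        simp [linCoeff_mul, linCoeff_X, smul_eq_C_mul]
      rw [h1, map_mul, aeval_X]; ring
    rw [h]
    refine add_mem (Ideal.mul_mem_mul (Ideal.subset_span (Set.mem_range_self i)) (hsub f))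
      (Ideal.mul_mem_mul ?_ (hu i))
    rw [mem_idealPlus_iff, map_sub, constantCoeff_aeval_of_forall hu0]
    simp

variable {n : ℕ} {p : Fin m → MvPolynomial (Fin n) k} {σ ι : Type}
  {q : σ → MvPolynomial (Fin n) k} {r : ι → MvPolynomial σ k}
  {t : σ → MvPolynomial (Fin m) k}

theorem constantCoeff_eq_zero_of_ker (hq0 : ∀ j, constantCoeff (q j) = 0)
    (hker : RingHom.ker (aeval q : MvPolynomial σ k →ₐ[k] _) = Ideal.span (Set.range r)) (c : ι) :
    constantCoeff (r c) = 0 := by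
  have h : r c ∈ RingHom.ker (aeval q : MvPolynomial σ k →ₐ[k] _) := by
    rw [hker]; exact Ideal.subset_span (Set.mem_range_self c)
  rw [RingHom.mem_ker] at h
  rw [← constantCoeff_aeval_of_forall hq0, h, map_zero]

theorem aeval_mem_span_of_ker [Fintype ι]
    (hker : RingHom.ker (aeval q : MvPolynomial σ k →ₐ[k] _) = Ideal.span (Set.range r))
    {g : MvPolynomial σ k} (hg : aeval q g = 0) :
    ∃ a : ι → MvPolynomial σ k, g = ∑ c, a c * r c := by
  have h : g ∈ RingHom.ker (aeval q : MvPolynomial σ k →ₐ[k] _) := hg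
  rw [hker, Ideal.mem_span_range_iff_exists_fun] at h
  obtain ⟨a, ha⟩ := h
  exact ⟨a, ha.symm⟩

/-- If the relations between `p` have no linear terms, they agree modulo `A_+ I` with the
pull-backs of the relations of any other presentation. -/
theorem mem_span_sup_of_mem_relIdeal [Fintype ι] (hp0 : ∀ i, constantCoeff (p i) = 0)
    (hmin : ∀ f ∈ relIdeal p, ∀ i, linCoeff i f = 0)
    (hker : RingHom.ker (aeval q : MvPolynomial σ k →ₐ[k] _) = Ideal.span (Set.range r))
    (hpq : ∀ i, p i ∈ (aeval q : MvPolynomial σ k →ₐ[k] _).range)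
    (ht : ∀ j, aeval p (t j) = q j) {f : MvPolynomial (Fin m) k} (hf : f ∈ relIdeal p) :
    ∃ g ∈ Ideal.span (Set.range fun c => aeval t (r c)), f - g ∈ idealPlus k m * relIdeal p := by
  choose φ hφ using hpq
  have hcomp : ∀ g, aeval p (aeval t g) = aeval q g := fun g => by
    rw [← AlgHom.comp_apply, comp_aeval]; simp only [ht]
  have hcomp' : ∀ g, aeval q (aeval φ g) = aeval p g := fun g => by
    rw [← AlgHom.comp_apply, comp_aeval]
    exact congrArg (fun v => aeval v g) (funext hφ)
  have hI : relIdeal p ≤ idealPlus k m := fun g hg => by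
    rw [mem_idealPlus_iff, ← constantCoeff_aeval_of_forall hp0, (RingHom.mem_ker).1 hg, map_zero]
  have hu : ∀ i, X i - aeval t (φ i) ∈ relIdeal p := fun i => by
    rw [relIdeal, RingHom.mem_ker, map_sub, hcomp, aeval_X, ← hφ i]
    exact sub_self _
  have h1 := sub_aeval_sub_sum_linCoeff_mem hI hu f
  simp only [hmin f hf, zero_smul, Finset.sum_const_zero, sub_zero] at h1
  refine ⟨_, ?_, h1⟩
  have h2 : aeval (fun i => aeval t (φ i)) f = aeval t (aeval φ f) := by
    rw [← AlgHom.comp_apply, comp_aeval]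
  obtain ⟨a, ha⟩ := aeval_mem_span_of_ker hker (g := aeval φ f) (by rw [hcomp']; exact hf)
  rw [h2, ha, map_sum]
  refine sum_mem fun c _ => ?_
  rw [map_mul]
  exact Ideal.mul_mem_left _ _ (Ideal.subset_span ⟨c, rfl⟩)

theorem finrank_map_modPlus_le [Fintype σ] [Fintype ι] (hp0 : ∀ i, constantCoeff (p i) = 0)
    (hq0 : ∀ j, constantCoeff (q j) = 0)
    (hker : RingHom.ker (aeval q : MvPolynomial σ k →ₐ[k] _) = Ideal.span (Set.range r))
    (hpq : ∀ i, p i ∈ (aeval q : MvPolynomial σ k →ₐ[k] _).range)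
    (ht : ∀ j, aeval p (t j) = q j) :
    FiniteDimensional k (((relIdeal p).restrictScalars k).map (modPlus (relIdeal p))) ∧
    Module.finrank k (((relIdeal p).restrictScalars k).map (modPlus (relIdeal p)))
      + Fintype.card σ ≤ m + Fintype.card ι := by
  classical
  choose φ hφ using hpq
  have hcomp : ∀ g, aeval p (aeval t g) = aeval q g := fun g => by
    rw [← AlgHom.comp_apply, comp_aeval]; simp only [ht]
  have hcomp' : ∀ g, aeval q (aeval φ g) = aeval p g := fun g => by
    rw [← AlgHom.comp_apply, comp_aeval]
    exact congrArg (fun v => aeval v g) (funext hφ)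
  have hI : relIdeal p ≤ idealPlus k m := fun g hg => by
    rw [mem_idealPlus_iff, ← constantCoeff_aeval_of_forall hp0, (RingHom.mem_ker).1 hg, map_zero]
  have hφ0 : ∀ i, constantCoeff (φ i) = 0 := fun i => by
    rw [← constantCoeff_aeval_of_forall hq0, ← hp0 i]
    exact congrArg _ (hφ i)
  have ht0 : ∀ j, constantCoeff (t j) = 0 := fun j => by
    rw [← constantCoeff_aeval_of_forall hp0, ht, hq0]
  have hr0 := constantCoeff_eq_zero_of_ker hq0 hker
  have hr : ∀ c, aeval q (r c) = 0 := fun c => by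
    have h : r c ∈ RingHom.ker (aeval q : MvPolynomial σ k →ₐ[k] _) := by
      rw [hker]; exact Ideal.subset_span (Set.mem_range_self c)
    exact h
  have hu : ∀ i, X i - aeval t (φ i) ∈ relIdeal p := fun i => by
    rw [relIdeal, RingHom.mem_ker, map_sub, hcomp, aeval_X, ← hφ i]
    exact sub_self _
  have hρ : ∀ c, aeval t (r c) ∈ relIdeal p := fun c => by
    rw [relIdeal, RingHom.mem_ker, hcomp, hr]
  have htaylor := sub_aeval_sub_sum_linCoeff_mem hI hu
  have hcomp2 : ∀ g, aeval (fun i => aeval t (φ i)) g = aeval t (aeval φ g) := fun g => by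
    rw [← AlgHom.comp_apply, comp_aeval]
  -- the spanning family of `I / A_+ I`
  set v : Fin m ⊕ ι → MvPolynomial (Fin m) k :=
    Sum.elim (fun i => X i - aeval t (φ i)) (fun c => aeval t (r c)) with hv
  have hvI : ∀ x, v x ∈ relIdeal p := by rintro (i | c); exacts [hu i, hρ c]
  set Θ : (Fin m ⊕ ι → k) →ₗ[k] _ :=
    Fintype.linearCombination k (fun x => modPlus (relIdeal p) (v x))
    with hΘ
  have hker0 : ∀ f, f ∈ idealPlus k m * relIdeal p → modPlus (relIdeal p) f = 0 := fun f hf =>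
    (Submodule.Quotient.mk_eq_zero _).2 hf
  have hmul : ∀ g c, modPlus (relIdeal p) (aeval t g * aeval t (r c))
      = constantCoeff g • modPlus (relIdeal p) (aeval t (r c)) := fun g c => by
    rw [← map_smul, ← sub_eq_zero, ← map_sub]
    apply hker0
    rw [smul_eq_C_mul, ← sub_mul]
    refine Ideal.mul_mem_mul ?_ (hρ c)
    rw [mem_idealPlus_iff, map_sub, constantCoeff_aeval_of_forall ht0, constantCoeff_C, sub_self]
  have hrange : ((relIdeal p).restrictScalars k).map (modPlus (relIdeal p)) =
      LinearMap.range Θ := by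
    rw [hΘ, Fintype.range_linearCombination]
    apply le_antisymm
    · rintro _ ⟨f, hf, rfl⟩
      have h1 := hker0 _ (htaylor f)
      obtain ⟨a, ha⟩ := aeval_mem_span_of_ker hker (g := aeval φ f) (by rw [hcomp']; exact hf)
      rw [hcomp2, ha, map_sub, map_sub, sub_sub, sub_eq_zero] at h1
      rw [h1]
      simp only [map_sum, map_mul, hmul, map_smul]
      refine add_mem (sum_mem fun c _ => Submodule.smul_mem _ _
        (Submodule.subset_span ⟨.inr c, rfl⟩))
        (sum_mem fun i _ => Submodule.smul_mem _ _ (Submodule.subset_span ⟨.inl i, rfl⟩))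
    · rw [Submodule.span_le]
      rintro _ ⟨x, rfl⟩
      exact Submodule.mem_map_of_mem (hvI x)
  have hrel : ∀ j, ∃ a : ι → MvPolynomial σ k, X j - aeval φ (t j) = ∑ c, a c * r c := fun j => by
    apply aeval_mem_span_of_ker hker
    rw [map_sub, hcomp', aeval_X, ht, sub_self]
  choose a ha using hrel
  set Λ : (σ → k) →ₗ[k] (Fin m ⊕ ι → k) := Fintype.linearCombination k
    (fun j => Sum.elim (fun i => linCoeff i (t j)) (fun c => - constantCoeff (a j c))) with hΛ
  have hΘΛ : LinearMap.range Λ ≤ LinearMap.ker Θ := by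
    rw [hΛ, Fintype.range_linearCombination, Submodule.span_le]
    rintro _ ⟨j, rfl⟩
    rw [SetLike.mem_coe, LinearMap.mem_ker, hΘ, Fintype.linearCombination_apply,
      Fintype.sum_sum_type]
    have h1 := hker0 _ (htaylor (t j))
    have h2 : t j - aeval t (aeval φ (t j)) = ∑ c, aeval t (a j c) * aeval t (r c) := by
      have := congrArg (aeval t) (ha j)
      simpa using this
    rw [hcomp2, h2, map_sub, sub_eq_zero] at h1
    simp only [map_sum, hmul, map_smul] at h1
    simp only [Sum.elim_inl, Sum.elim_inr, hv, neg_smul, Finset.sum_neg_distrib, h1]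
    exact add_neg_cancel _
  have hΛinj : Function.Injective Λ := by
    rw [← LinearMap.ker_eq_bot, LinearMap.ker_eq_bot']
    intro l hl
    have hl1 : ∀ i, ∑ j, l j * linCoeff i (t j) = 0 := fun i => by
      simpa [hΛ, Fintype.linearCombination_apply] using congrFun hl (.inl i)
    have hl2 : ∀ c, ∑ j, l j * constantCoeff (a j c) = 0 := fun c => by
      simpa [hΛ, Fintype.linearCombination_apply] using congrFun hl (.inr c)
    funext j₀
    have h1 : ∀ j, linCoeff j₀ (X j) - ∑ i, linCoeff i (t j) * linCoeff j₀ (φ i)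
        = ∑ c, constantCoeff (a j c) * linCoeff j₀ (r c) := fun j => by
      have := congrArg (linCoeff j₀) (ha j)
      simpa only [map_sub, map_sum, linCoeff_aeval hφ0, linCoeff_mul, hr0, zero_mul,
        add_zero] using this
    have h2 : ∑ j, l j * (linCoeff j₀ (X j) - ∑ i, linCoeff i (t j) * linCoeff j₀ (φ i))
        = ∑ j, l j * ∑ c, constantCoeff (a j c) * linCoeff j₀ (r c) :=
      Finset.sum_congr rfl fun j _ => by rw [h1]
    simp only [mul_sub, Finset.mul_sum, Finset.sum_sub_distrib, ← mul_assoc] at h2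
    rw [Finset.sum_comm, Finset.sum_comm (s := Finset.univ) (t := (Finset.univ : Finset ι))] at h2
    simp only [← Finset.sum_mul, hl1, hl2] at h2
    simpa [linCoeff_X] using h2
  have hfr := LinearMap.finrank_range_add_finrank_ker Θ
  have hle := Submodule.finrank_mono hΘΛ
  rw [LinearMap.finrank_range_of_inj hΛinj, Module.finrank_fintype_fun_eq_card] at hle
  rw [Module.finrank_fintype_fun_eq_card, Fintype.card_sum, Fintype.card_fin] at hfr
  rw [hrange]
  exact ⟨inferInstance, by omega⟩

theorem isCompleteIntersection_of_presentation [CharZero k] [Fintype σ] [Fintype ι]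
    {d : Fin m → ℕ} (hd : ∀ i, 0 < d i)
    (hp : ∀ i, (p i).IsHomogeneous (d i))
    (hq0 : ∀ j, constantCoeff (q j) = 0)
    (hker : RingHom.ker (aeval q : MvPolynomial σ k →ₐ[k] _) = Ideal.span (Set.range r))
    (hpq : ∀ i, p i ∈ (aeval q : MvPolynomial σ k →ₐ[k] _).range)
    (ht : ∀ j, aeval p (t j) = q j) (hcard : Fintype.card σ = n + Fintype.card ι) :
    IsCompleteIntersection p := by
  classical
  have hp0 : ∀ i, constantCoeff (p i) = 0 := fun i =>
    constantCoeff_eq_zero_of_isWeightedHomogeneous (hp i) (hd i).ne'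
  obtain ⟨hfin, hle⟩ := finrank_map_modPlus_le hp0 hq0 hker hpq ht
  have hle' : Module.finrank k (((relIdeal p).restrictScalars k).map (modPlus (relIdeal p)))
      ≤ m - n := by omega
  obtain ⟨s, hs, hspan⟩ := exists_finset_span_eq_of_finrank_le hd (I := relIdeal p)
    (fun f hf e => by
    rw [relIdeal, RingHom.mem_ker] at hf ⊢
    rw [← weightedHomogeneousComponent_aeval hp, hf, map_zero]) hle'
  by_cases hbot : relIdeal p = ⊥
  · refine ⟨∅, ?_, by simp [hbot]⟩
    have hinj : AlgebraicIndependent k p := by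
      rw [AlgebraicIndependent, RingHom.injective_iff_ker_eq_bot]; exact hbot
    have h1 := hinj.cardinalMk_le_trdeg
    rw [trdeg_of_isDomain] at h1
    have h2 : m ≤ n := by simpa using h1
    rw [Finset.card_empty, Nat.sub_eq_zero_of_le h2]
  · have hinf : (relIdeal p : Set (MvPolynomial (Fin m) k)).Infinite := by
      obtain ⟨f, hf, hf0⟩ := Submodule.exists_mem_ne_zero_of_ne_bot hbot
      refine Set.infinite_of_injective_forall_mem (f := fun c : k => c • f) ?_ ?_
      · intro a b hab
        exact smul_left_injective k hf0 hab
      · intro c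
        exact Submodule.smul_of_tower_mem _ c hf
    obtain ⟨t', ht'I, ht'⟩ := hinf.exists_subset_card_eq (m - n)
    obtain ⟨s', hss', hs't, hs'⟩ := Finset.exists_subsuperset_card_eq
      (Finset.subset_union_left (s₁ := s) (s₂ := t')) hs
      (ht'.symm.le.trans (Finset.card_le_card Finset.subset_union_right))
    refine ⟨s', hs', le_antisymm (Ideal.span_le.2 fun x hx => ?_) ?_⟩
    · rcases Finset.mem_union.1 (hs't hx) with h | h
      · exact hspan ▸ Ideal.subset_span h
      · exact ht'I h
    · rw [← hspan]
      exact Ideal.span_mono (by exact_mod_cast hss')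

end Comparison

section Averaging

variable {Γ : Type*} [Group Γ] {A B : Type*} [CommRing A] [Algebra k A] [CommRing B] [Algebra k B]

/-- The invariants of a group acting by algebra endomorphisms. -/
def fixedAlg (ρ : Γ →* (B →ₐ[k] B)) : Subalgebra k B where
  carrier := {f | ∀ g, ρ g f = f}
  mul_mem' ha hb g := by rw [map_mul, ha g, hb g]
  add_mem' ha hb g := by rw [map_add, ha g, hb g]
  algebraMap_mem' r g := (ρ g).commutes r

theorem mem_fixedAlg {ρ : Γ →* (B →ₐ[k] B)} {f : B} : f ∈ fixedAlg ρ ↔ ∀ g, ρ g f = f := Iff.rfl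

/-- `f` is a semi-invariant of character `χ`. -/
def IsSemiInv (ρ : Γ →* (B →ₐ[k] B)) (χ : Γ →* kˣ) (f : B) : Prop :=
  ∀ g, ρ g f = (χ g : k) • f

theorem isSemiInv_one_iff {ρ : Γ →* (B →ₐ[k] B)} {f : B} :
    IsSemiInv ρ 1 f ↔ f ∈ fixedAlg ρ := by
  simp [IsSemiInv, mem_fixedAlg]

theorem IsSemiInv.mul {ρ : Γ →* (B →ₐ[k] B)} {χ ψ : Γ →* kˣ} {f g : B}
    (hf : IsSemiInv ρ χ f) (hg : IsSemiInv ρ ψ g) : IsSemiInv ρ (χ * ψ) (f * g) := fun w => by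
  rw [map_mul, hf, hg, MonoidHom.mul_apply, Units.val_mul, smul_mul_smul_comm]

theorem IsSemiInv.one {ρ : Γ →* (B →ₐ[k] B)} : IsSemiInv ρ 1 (1 : B) :=
  isSemiInv_one_iff.2 (one_mem _)

theorem IsSemiInv.pow {ρ : Γ →* (B →ₐ[k] B)} {χ : Γ →* kˣ} {f : B}
    (hf : IsSemiInv ρ χ f) (N : ℕ) : IsSemiInv ρ ((powMonoidHom N).comp χ) (f ^ N) := fun g => by
  rw [map_pow, hf g, smul_pow]; simp

theorem IsSemiInv.prod {ρ : Γ →* (B →ₐ[k] B)} {ι : Type*} (s : Finset ι) {χ : ι → Γ →* kˣ}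
    {f : ι → B} (hf : ∀ i, IsSemiInv ρ (χ i) (f i)) :
    IsSemiInv ρ (∏ i ∈ s, χ i) (∏ i ∈ s, f i) := by
  classical
  induction s using Finset.induction_on with
  | empty => simpa using IsSemiInv.one (ρ := ρ)
  | insert a s ha ih => rw [Finset.prod_insert ha, Finset.prod_insert ha]; exact (hf a).mul ih

theorem exists_isSemiInv [IsDomain B] [Finite Γ] (ρ : Γ →* (B →ₐ[k] B)) {f : B} (hf0 : f ≠ 0)
    (hf : ∀ g, ∃ c : k, ρ g f = c • f) : ∃ χ : Γ →* kˣ, IsSemiInv ρ χ f := by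
  choose c hc using hf
  have hinj := smul_left_injective k hf0
  let χ : Γ →* k :=
    { toFun := c
      map_one' := hinj (by simp [← hc])
      map_mul' := fun a b => hinj (by
        have : ρ (a * b) f = ρ a (ρ b f) := by rw [map_mul]; rfl
        rw [hc, hc b, map_smul, hc a, smul_smul, mul_comm] at this
        exact this) }
  exact ⟨χ.toHomUnits, fun g => hc g⟩

variable [Fintype Γ]

/-- The projection onto the semi-invariants of character `χ`. -/
def charAvg (ρ : Γ →* (B →ₐ[k] B)) (χ : Γ →* kˣ) : B →ₗ[k] B :=
  (Fintype.card Γ : k)⁻¹ • ∑ g, (χ g⁻¹ : k) • (ρ g).toLinearMap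

theorem charAvg_apply (ρ : Γ →* (B →ₐ[k] B)) (χ : Γ →* kˣ) (f : B) :
    charAvg ρ χ f = (Fintype.card Γ : k)⁻¹ • ∑ g, (χ g⁻¹ : k) • ρ g f := by
  simp [charAvg]

theorem isSemiInv_charAvg (ρ : Γ →* (B →ₐ[k] B)) (χ : Γ →* kˣ) (f : B) :
    IsSemiInv ρ χ (charAvg ρ χ f) := fun h => by
  rw [charAvg_apply, map_smul, smul_comm (χ h : k)]
  congr 1
  rw [map_sum, Finset.smul_sum, ← Equiv.sum_comp (Equiv.mulLeft h)
    (fun g => (χ h : k) • (χ g⁻¹ : k) • ρ g f)]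
  refine Finset.sum_congr rfl fun g _ => ?_
  have : ρ (h * g) f = ρ h (ρ g f) := by rw [map_mul]; rfl
  rw [map_smul, Equiv.coe_mulLeft, this, smul_smul, ← Units.val_mul, mul_inv_rev, map_mul,
    mul_comm (χ g⁻¹), ← mul_assoc, ← map_mul, mul_inv_cancel, map_one, one_mul]

theorem charAvg_map {τ : Γ →* (A →ₐ[k] A)} {ρ : Γ →* (B →ₐ[k] B)} (χ : Γ →* kˣ) (π : A →ₐ[k] B)
    (hπ : ∀ g a, π (τ g a) = ρ g (π a)) (a : A) : π (charAvg τ χ a) = charAvg ρ χ (π a) := by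
  simp [charAvg_apply, hπ]

theorem charAvg_one_mul {ρ : Γ →* (B →ₐ[k] B)} {r : B} (hr : r ∈ fixedAlg ρ) (f : B) :
    charAvg ρ 1 (f * r) = charAvg ρ 1 f * r := by
  simp [charAvg_apply, mem_fixedAlg.1 hr, Finset.sum_mul]

theorem IsSemiInv.charAvg_eq [CharZero k] {ρ : Γ →* (B →ₐ[k] B)} {χ : Γ →* kˣ} {f : B}
    (hf : IsSemiInv ρ χ f) : charAvg ρ χ f = f := by
  have h : (Fintype.card Γ : k) ≠ 0 := Nat.cast_ne_zero.2 Fintype.card_ne_zero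
  rw [charAvg_apply]
  have : ∀ g, (χ g⁻¹ : k) • ρ g f = f := fun g => by
    rw [hf g, smul_smul, ← Units.val_mul, ← map_mul]; simp
  simp only [this, Finset.sum_const, Finset.card_univ, ← Nat.cast_smul_eq_nsmul k, smul_smul]
  rw [inv_mul_cancel₀ h, one_smul]

theorem IsSemiInv.charAvg_eq_zero {ρ : Γ →* (B →ₐ[k] B)} {χ ψ : Γ →* kˣ} {f : B}
    (hf : IsSemiInv ρ ψ f) (h : χ ≠ ψ) : charAvg ρ χ f = 0 := by
  rw [charAvg_apply]
  have h1 : (Units.coeHom k).comp (χ⁻¹ * ψ) ≠ 1 := fun h1 => h (by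
    have h2 : χ⁻¹ * ψ = 1 := by
      ext g
      simpa using DFunLike.congr_fun h1 g
    exact inv_mul_eq_one.1 h2)
  have h2 := sum_hom_units_eq_zero _ h1
  have h3 : ∀ g, (χ g⁻¹ : k) • ρ g f = ((Units.coeHom k).comp (χ⁻¹ * ψ)) g • f := fun g => by
    rw [hf g, smul_smul]; simp
  simp only [h3, ← Finset.sum_smul, h2, zero_smul, smul_zero]

end Averaging

section Kummer

variable {Γ : Type*} [Group Γ] [Fintype Γ] {B : Type*} [CommRing B] [IsDomain B]
  [Algebra k B] {ρ : Γ →* (B →ₐ[k] B)} {σ ι : Type} [Fintype ι]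
  {F : σ → B} {y : ι → B} {θ : ι → Γ →* kˣ} {e : ι → ℕ} {D : ι → MvPolynomial σ k}

/-- The relation `Z_c ^ e_c = D_c(Y)`. -/
def kummerRel (e : ι → ℕ) (D : ι → MvPolynomial σ k) (c : ι) : MvPolynomial (σ ⊕ ι) k :=
  X (Sum.inr c) ^ e c - rename Sum.inl (D c)

theorem exists_reduced_sub_mem [Fintype σ] [DecidableEq ι] (he : ∀ c, 0 < e c)
    (Q : MvPolynomial (σ ⊕ ι) k) :
    ∃ b : (∀ c, Fin (e c)) → MvPolynomial σ k,
      Q - ∑ a, rename Sum.inl (b a) * ∏ c, X (Sum.inr c) ^ (a c : ℕ)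
        ∈ Ideal.span (Set.range (kummerRel e D)) := by
  induction Q using MvPolynomial.induction_on' with
  | monomial u r =>
    let a₀ : ∀ c, Fin (e c) := fun c => ⟨u (Sum.inr c) % e c, Nat.mod_lt _ (he c)⟩
    refine ⟨Pi.single a₀
      (monomial (u.comapDomain Sum.inl Sum.inl_injective.injOn) r
        * ∏ c, D c ^ (u (Sum.inr c) / e c)), ?_⟩
    rw [Finset.sum_eq_single a₀]
    rotate_left
    · intro a _ ha; rw [Pi.single_eq_of_ne ha]; simp
    · simp
    rw [Pi.single_eq_same, ← Ideal.Quotient.eq]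
    have hmon : monomial u r = rename (Sum.inl (β := ι))
        (monomial (u.comapDomain Sum.inl Sum.inl_injective.injOn) r)
        * ∏ c, X (Sum.inr c) ^ u (Sum.inr c) := by
      rw [rename_monomial, monomial_eq, monomial_eq, Finsupp.prod_fintype _ _ (by simp),
        Fintype.prod_sum_type, Finsupp.prod_mapDomain_index_inj Sum.inl_injective,
        Finsupp.prod_fintype _ _ (by simp), mul_assoc]
      rfl
    rw [hmon]
    simp only [map_mul, map_prod, map_pow, mul_assoc, ← Finset.prod_mul_distrib]
    congr 1
    refine Finset.prod_congr rfl fun c _ => ?_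
    have h : Ideal.Quotient.mk (Ideal.span (Set.range (kummerRel e D))) (X (Sum.inr c)) ^ e c
        = Ideal.Quotient.mk _ (rename Sum.inl (D c)) := by
      rw [← map_pow, Ideal.Quotient.eq]
      exact Ideal.subset_span ⟨c, rfl⟩
    rw [← h, ← pow_mul, ← pow_add, Nat.div_add_mod]
  | add P Q hP hQ =>
    obtain ⟨b, hb⟩ := hP
    obtain ⟨b', hb'⟩ := hQ
    refine ⟨b + b', ?_⟩
    convert add_mem hb hb' using 1
    simp only [Pi.add_apply, map_add, add_mul, Finset.sum_add_distrib]
    ring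

theorem ker_aeval_sumElim [CharZero k] [Fintype σ] (hF : AlgebraicIndependent k F)
    (hFfix : ∀ i, F i ∈ fixedAlg ρ)
    (hy0 : ∀ c, y c ≠ 0) (hy : ∀ c, IsSemiInv ρ (θ c) (y c))
    (hθ : ∀ a : ι → ℤ, (∀ g, ∏ c, θ c g ^ a c = 1) → ∀ c g, θ c g ^ a c = 1)
    (he : ∀ c (z : ℤ), (∀ g, θ c g ^ z = 1) → (e c : ℤ) ∣ z) (he0 : ∀ c, 0 < e c)
    (hD : ∀ c, aeval F (D c) = y c ^ e c) :
    RingHom.ker (aeval (Sum.elim F y) : MvPolynomial (σ ⊕ ι) k →ₐ[k] B)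
      = Ideal.span (Set.range (kummerRel e D)) := by
  classical
  have hinl : ∀ g : MvPolynomial σ k, aeval (Sum.elim F y) (rename Sum.inl g) = aeval F g :=
    fun g => by rw [aeval_rename]; rfl
  have hle : Ideal.span (Set.range (kummerRel e D))
      ≤ RingHom.ker (aeval (Sum.elim F y) : MvPolynomial (σ ⊕ ι) k →ₐ[k] B) := by
    rw [Ideal.span_le]
    rintro _ ⟨c, rfl⟩
    rw [SetLike.mem_coe, RingHom.mem_ker, kummerRel, map_sub, hinl, hD]
    simp
  refine le_antisymm (fun Q hQ => ?_) hle
  obtain ⟨b, hb⟩ := exists_reduced_sub_mem (D := D) he0 Q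
  have h1 := hle hb
  rw [RingHom.mem_ker] at h1 hQ
  simp only [map_sub, hQ, map_sum, map_mul, hinl, map_prod, map_pow, aeval_X, Sum.elim_inr,
    zero_sub, neg_eq_zero] at h1
  have hsemi : ∀ a : (∀ c, Fin (e c)), IsSemiInv ρ (∏ c, (powMonoidHom (a c : ℕ)).comp (θ c))
      (aeval F (b a) * ∏ c, y c ^ (a c : ℕ)) := fun a => by
    have h2 : aeval F (b a) ∈ fixedAlg ρ := by
      intro g
      rw [← AlgHom.comp_apply, comp_aeval]
      simp only [mem_fixedAlg.1 (hFfix _)]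
    have h3 := (isSemiInv_one_iff.2 h2).mul (IsSemiInv.prod Finset.univ fun c => (hy c).pow (a c))
    exact fun g => (h3 g).trans (by rw [MonoidHom.mul_apply, MonoidHom.one_apply, one_mul])
  have hinj : ∀ a a' : (∀ c, Fin (e c)), ∏ c, (powMonoidHom (a c : ℕ)).comp (θ c) =
      ∏ c, (powMonoidHom (a' c : ℕ)).comp (θ c) → a = a' := by
    intro a a' h
    have h2 : ∀ g, ∏ c, θ c g ^ ((a c : ℤ) - (a' c : ℤ)) = 1 := fun g => by
      have h3 := DFunLike.congr_fun h g
      simp only [MonoidHom.finsetProd_apply, MonoidHom.comp_apply, powMonoidHom_apply] at h3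
      simp only [zpow_sub, zpow_natCast, Finset.prod_mul_distrib, Finset.prod_inv_distrib, h3,
        mul_inv_cancel]
    funext c
    have h3 := he c _ (hθ _ h2 c)
    have h4 := (a c).2
    have h5 := (a' c).2
    have h6 := Int.eq_zero_of_abs_lt_dvd h3 (by rw [abs_lt]; constructor <;> omega)
    ext; omega
  have hb0 : ∀ a, b a = 0 := fun a => by
    have h2 := congrArg (charAvg ρ (∏ c, (powMonoidHom (a c : ℕ)).comp (θ c))) h1
    rw [map_sum, map_zero, Finset.sum_eq_single a, (hsemi a).charAvg_eq] at h2
    · have h3 : aeval F (b a) = 0 := (mul_eq_zero.1 h2).resolve_right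
        (Finset.prod_ne_zero_iff.2 fun c _ => pow_ne_zero _ (hy0 c))
      exact hF.eq_zero_of_aeval_eq_zero _ h3
    · intro a' _ ha'
      exact (hsemi a').charAvg_eq_zero fun h => ha' (hinj _ _ h).symm
    · simp
  simpa [hb0] using hb

end Kummer

section Irredundant

variable {B : Type*} [CommRing B] [Algebra k B] {ι : Type*} [DecidableEq ι]

/-- No `f i` with `i ∈ M` is a combination of the others with coefficients in `R`. -/
def Irredundant (R : Subalgebra k B) (f : ι → B) (M : Finset ι) : Prop :=
  ∀ i ∈ M, ∀ c : ι → B, (∀ j, c j ∈ R) → f i ≠ ∑ j ∈ M.erase i, c j * f j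

theorem exists_irredundant (R : Subalgebra k B) (f : ι → B) (s : Finset ι) :
    ∃ M ⊆ s, Irredundant R f M ∧
      ∀ j ∈ s, ∃ c : ι → B, (∀ i, c i ∈ R) ∧ f j = ∑ i ∈ M, c i * f i := by
  let T : Set (Finset ι) := {M | M ⊆ s ∧
    ∀ j ∈ s, ∃ c : ι → B, (∀ i, c i ∈ R) ∧ f j = ∑ i ∈ M, c i * f i}
  have hs : s ∈ T := ⟨subset_rfl, fun j hj => ⟨Pi.single j 1, fun i => by
    by_cases h : i = j
    · subst h; simp
    · simp [h], by simp [Pi.single_apply, hj]⟩⟩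
  obtain ⟨M, hM, hmin⟩ := WellFounded.has_min (measure Finset.card).wf T ⟨s, hs⟩
  refine ⟨M, hM.1, fun i hi c hc h => ?_, hM.2⟩
  refine hmin (M.erase i) ⟨(M.erase_subset i).trans hM.1, fun j hj => ?_⟩
    (Finset.card_erase_lt_of_mem hi)
  obtain ⟨a, ha, haj⟩ := hM.2 j hj
  refine ⟨fun l => a i * c l + a l, fun l => add_mem (mul_mem (ha i) (hc l)) (ha l), ?_⟩
  rw [haj, ← Finset.add_sum_erase _ _ hi, h]
  simp only [Finset.mul_sum, add_mul, Finset.sum_add_distrib, mul_assoc]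

theorem Irredundant.constantCoeff_eq_zero {σ : Type*} {R : Subalgebra k (MvPolynomial σ k)}
    (hR : ∀ e, ∀ f ∈ R, homogeneousComponent e f ∈ R) {f : ι → MvPolynomial σ k} {M : Finset ι}
    (h : Irredundant R f M) {d : ι → ℕ} (hf : ∀ i, (f i).IsHomogeneous (d i))
    {b : ι → MvPolynomial σ k} (hb : ∀ i, b i ∈ R) (hs : ∑ i ∈ M, b i * f i = 0)
    {i : ι} (hi : i ∈ M) : constantCoeff (b i) = 0 := by
  by_contra hne
  have h1 := congrArg (homogeneousComponent (d i)) hs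
  have h2 : ∀ j, homogeneousComponent (d i) (b j * f j)
      = (if d j ≤ d i then homogeneousComponent (d i - d j) (b j) else 0) * f j := fun j => by
    rw [mul_comm]
    exact (weightedHomogeneousComponent_mul_of_isWeightedHomogeneous (hf j) (b j) (d i)).trans
      (by split_ifs <;> simp [mul_comm, homogeneousComponent])
  rw [map_sum, map_zero, ← Finset.add_sum_erase _ _ hi] at h1
  simp only [h2, le_refl, if_true, Nat.sub_self, homogeneousComponent_zero] at h1
  refine h i hi (fun j => C (-(constantCoeff (b i))⁻¹)
    * (if d j ≤ d i then homogeneousComponent (d i - d j) (b j) else 0)) (fun j => ?_) ?_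
  · refine mul_mem (R.algebraMap_mem _) ?_
    split_ifs
    · exact hR _ _ (hb j)
    · exact zero_mem R
  · simp only [mul_assoc]
    rw [← Finset.mul_sum, ← neg_eq_of_add_eq_zero_right h1, mul_neg, ← mul_assoc, ← C_mul,
      ← constantCoeff_eq, neg_mul, inv_mul_cancel₀ hne]
    simp

end Irredundant

section Chevalley

variable {n : ℕ} {Γ : Type*} [Group Γ]
  {ρ : Γ →* (MvPolynomial (Fin n) k →ₐ[k] MvPolynomial (Fin n) k)}

theorem homogeneousComponent_map (hρ : ∀ g i, (ρ g (X i)).IsHomogeneous 1) (g : Γ)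
    (f : MvPolynomial (Fin n) k) (e : ℕ) :
    homogeneousComponent e (ρ g f) = ρ g (homogeneousComponent e f) := by
  rw [aeval_unique (ρ g)]
  exact weightedHomogeneousComponent_aeval (w := 1) (hρ g) f e

theorem homogeneousComponent_mem_fixedAlg (hρ : ∀ g i, (ρ g (X i)).IsHomogeneous 1) (e : ℕ)
    (f : MvPolynomial (Fin n) k) (hf : f ∈ fixedAlg ρ) : homogeneousComponent e f ∈ fixedAlg ρ :=
  fun g => by rw [← homogeneousComponent_map hρ, hf g]

theorem isHomogeneous_map (hρ : ∀ g i, (ρ g (X i)).IsHomogeneous 1) (g : Γ)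
    {f : MvPolynomial (Fin n) k} {e : ℕ} (hf : f.IsHomogeneous e) : (ρ g f).IsHomogeneous e := by
  rw [aeval_unique (ρ g)]
  exact isWeightedHomogeneous_aeval (w := 1) (hρ g) hf

theorem totalDegree_map_le (hρ : ∀ g i, (ρ g (X i)).IsHomogeneous 1) (g : Γ)
    (f : MvPolynomial (Fin n) k) : (ρ g f).totalDegree ≤ f.totalDegree := by
  conv_lhs => rw [← sum_homogeneousComponent f, map_sum]
  refine totalDegree_finsetSum_le fun e he => ?_
  refine (isHomogeneous_map hρ g (homogeneousComponent_isHomogeneous e f)).totalDegree_le.trans ?_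
  exact Nat.lt_succ_iff.1 (Finset.mem_range.1 he)

/-- The ideal generated by the invariants of positive degree. -/
def hilbertIdeal (ρ : Γ →* (MvPolynomial (Fin n) k →ₐ[k] MvPolynomial (Fin n) k)) :
    Ideal (MvPolynomial (Fin n) k) :=
  Ideal.span {f | f ∈ fixedAlg ρ ∧ constantCoeff f = 0}

theorem map_mem_hilbertIdeal (g : Γ) {f : MvPolynomial (Fin n) k} (hf : f ∈ hilbertIdeal ρ) :
    ρ g f ∈ hilbertIdeal ρ := by
  have h : hilbertIdeal ρ ≤ (hilbertIdeal ρ).comap (ρ g) := by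
    refine Ideal.span_le.2 fun f hf => ?_
    rw [SetLike.mem_coe, Ideal.mem_comap, hf.1 g]
    exact Ideal.subset_span hf
  exact h hf

theorem map_sub_mem_hilbertIdeal {S : Set Γ} (hS : Subgroup.closure S = ⊤)
    {f : MvPolynomial (Fin n) k} (hf : ∀ s ∈ S, ρ s f - f ∈ hilbertIdeal ρ) (g : Γ) :
    ρ g f - f ∈ hilbertIdeal ρ := by
  have hmul : ∀ a b, ρ (a * b) f = ρ a (ρ b f) := fun a b => by rw [map_mul]; rfl
  have hg : g ∈ Subgroup.closure S := hS ▸ Subgroup.mem_top g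
  induction hg using Subgroup.closure_induction with
  | mem s hs => exact hf s hs
  | one => simp
  | mul a b _ _ ha hb =>
    have := add_mem (map_mem_hilbertIdeal a hb) ha
    rwa [map_sub, sub_add_sub_cancel, ← hmul] at this
  | inv a _ ha =>
    have := neg_mem (map_mem_hilbertIdeal a⁻¹ ha)
    rwa [map_sub, ← hmul, inv_mul_cancel, map_one, AlgHom.one_apply, neg_sub] at this

variable [Fintype Γ] [CharZero k]

theorem charAvg_sub_mem_hilbertIdeal {f : MvPolynomial (Fin n) k}
    (hf : ∀ g, ρ g f - f ∈ hilbertIdeal ρ) : charAvg ρ 1 f - f ∈ hilbertIdeal ρ := by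
  have h : (Fintype.card Γ : k) ≠ 0 := Nat.cast_ne_zero.2 Fintype.card_ne_zero
  have h1 : charAvg ρ 1 f - f = C (Fintype.card Γ : k)⁻¹ * ∑ g, (ρ g f - f) := by
    rw [charAvg_apply, ← smul_eq_C_mul]
    simp only [MonoidHom.one_apply, Units.val_one, one_smul, Finset.sum_sub_distrib, smul_sub,
      Finset.sum_const, Finset.card_univ, ← Nat.cast_smul_eq_nsmul k]
    rw [smul_smul, inv_mul_cancel₀ h, one_smul]
  rw [h1]
  exact Ideal.mul_mem_left _ _ (Ideal.sum_mem _ fun g _ => hf g)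

/-- Chevalley's lemma. -/
theorem Irredundant.mem_hilbertIdeal {ι : Type*} [DecidableEq ι]
    (hρ : ∀ g i, (ρ g (X i)).IsHomogeneous 1)
    {S : Set Γ} (hS : Subgroup.closure S = ⊤) {α : Γ → MvPolynomial (Fin n) k}
    (hα : ∀ s ∈ S, (α s).IsHomogeneous 1) (hα0 : ∀ s ∈ S, α s ≠ 0)
    (hdvd : ∀ s ∈ S, ∀ f, α s ∣ ρ s f - f)
    {f : ι → MvPolynomial (Fin n) k} {M : Finset ι} (hM : Irredundant (fixedAlg ρ) f M)
    {d : ι → ℕ} (hf : ∀ i, (f i).IsHomogeneous (d i)) (hfix : ∀ i, f i ∈ fixedAlg ρ)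
    {i : ι} (hi : i ∈ M) (b : ι → MvPolynomial (Fin n) k) (hs : ∑ j ∈ M, b j * f j = 0) :
    b i ∈ hilbertIdeal ρ := by
  induction hN : (b i).totalDegree using Nat.strong_induction_on generalizing b with
  | _ N ih =>
    have hmem : ∀ s ∈ S, ρ s (b i) - b i ∈ hilbertIdeal ρ := fun s hsS => by
      choose h hh using fun j => hdvd s hsS (b j)
      rw [hh i]
      by_cases hz : h i = 0
      · simp [hz]
      refine Ideal.mul_mem_left _ _ (ih _ ?_ h ?_ rfl)
      · have h1 := totalDegree_mul_of_isDomain (hα0 s hsS) hz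
        rw [← hh i, (hα s hsS).totalDegree (hα0 s hsS)] at h1
        have h2 := totalDegree_sub (ρ s (b i)) (b i)
        have h3 := totalDegree_map_le hρ s (b i)
        have h4 := max_le h3 le_rfl
        omega
      · refine (mul_eq_zero.1 ?_).resolve_left (hα0 s hsS)
        have h1 := congrArg (ρ s) hs
        rw [map_sum, map_zero] at h1
        simp only [map_mul, (hfix _ s)] at h1
        rw [Finset.mul_sum]
        simp only [← mul_assoc, ← hh, sub_mul, Finset.sum_sub_distrib, h1, hs, sub_zero]
    have h1 := charAvg_sub_mem_hilbertIdeal (map_sub_mem_hilbertIdeal hS hmem)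
    have h2 : charAvg ρ 1 (b i) ∈ hilbertIdeal ρ := by
      refine Ideal.subset_span ⟨isSemiInv_one_iff.1 (isSemiInv_charAvg ρ 1 _), ?_⟩
      refine hM.constantCoeff_eq_zero (homogeneousComponent_mem_fixedAlg hρ) hf
        (b := fun j => charAvg ρ 1 (b j))
        (fun j => isSemiInv_one_iff.1 (isSemiInv_charAvg ρ 1 _)) ?_ hi
      simp only [← charAvg_one_mul (hfix _), ← map_sum, hs, map_zero]
    simpa using sub_mem h2 h1

end Chevalley

section Irredundant

theorem Irredundant.subtype {B : Type*} [CommRing B] [Algebra k B] {ι : Type*} [DecidableEq ι]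
    {R : Subalgebra k B} {f : ι → B} {M : Finset ι} (h : Irredundant R f M) :
    Irredundant R (fun i : ↥M => f i) Finset.univ := by
  intro i _ c hc hi
  let c' : ι → B := fun j => if hj : j ∈ M then c ⟨j, hj⟩ else 0
  have hc' : ∀ j : ↥M, c' j = c j := fun j => dif_pos j.2
  refine h i i.2 c' (fun j => ?_) (hi.trans ?_)
  · by_cases hj : j ∈ M
    · simpa [c', hj] using hc _
    · simp [c', hj]
  · have h1 := Finset.sum_coe_sort M (fun j => c' j * f j)
    rw [← Finset.add_sum_erase _ _ (Finset.mem_univ i), ← Finset.add_sum_erase _ _ i.2] at h1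
    simpa only [hc', add_right_inj] using h1

end Irredundant

theorem sum_mul_eq_zero_of_combination {B : Type*} [CommRing B] {ι : Type*} [Fintype ι]
    [DecidableEq ι] {M : Finset ι} {H P : ι → B} {c : ι → ι → B}
    (hc : ∀ j, H j = ∑ i ∈ M, c j i * H i) (h : ∑ i, H i * P i = 0) :
    ∑ i ∈ M, (P i + ∑ j ∈ Mᶜ, c j i * P j) * H i = 0 := by
  rw [← Finset.sum_add_sum_compl M,
    Finset.sum_congr rfl fun j (_ : j ∈ Mᶜ) => congrArg (· * P j) (hc j)] at h
  rw [← h]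
  simp only [add_mul, Finset.sum_add_distrib, Finset.sum_mul]
  rw [Finset.sum_comm (s := M)]
  congr 1
  · exact Finset.sum_congr rfl fun _ _ => mul_comm _ _
  · exact Finset.sum_congr rfl fun _ _ => Finset.sum_congr rfl fun _ _ => mul_right_comm _ _ _

section Derivatives

variable {σ τ : Type*}

theorem pderiv_aeval [Fintype σ] (F : σ → MvPolynomial τ k) (j : τ) (Q : MvPolynomial σ k) :
    pderiv j (aeval F Q) = ∑ i, aeval F (pderiv i Q) * pderiv j (F i) := by
  classical
  induction Q using MvPolynomial.induction_on with
  | C a => simp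
  | add f g hf hg => simp only [map_add, hf, hg, add_mul, Finset.sum_add_distrib]
  | mul_X f i hf =>
    simp only [map_mul, aeval_X, Derivation.leibniz, smul_eq_mul, hf, pderiv_X, map_add, add_mul,
      Finset.sum_add_distrib, Finset.mul_sum, mul_assoc]
    simp [Pi.single_apply]

theorem IsWeightedHomogeneous.pderiv_eq_zero {w : σ → ℕ} {Q : MvPolynomial σ k} {e : ℕ}
    (h : IsWeightedHomogeneous w Q e) {i : σ} (hi : e < w i) : pderiv i Q = 0 := by
  induction h using IsWeightedHomogeneous.induction_on with
  | zero => simp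
  | add a b _ _ iha ihb => simp [iha, ihb]
  | monomial u r hr =>
    have h1 : u i = 0 := by
      by_contra h0
      have := Finsupp.le_weight_of_ne_zero' w h0
      omega
    simp [pderiv_monomial, h1]

theorem exists_pderiv_ne_zero [CharZero k] [Fintype σ] {w : σ → ℕ} (hw : ∀ i, 0 < w i)
    {Q : MvPolynomial σ k} {e : ℕ} (h : IsWeightedHomogeneous w Q e) (hQ : Q ≠ 0)
    (hQ0 : constantCoeff Q = 0) : ∃ i, pderiv i Q ≠ 0 := by
  by_contra! h0
  have h1 := h.sum_weight_X_mul_pderiv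
  simp only [h0, mul_zero, smul_zero, Finset.sum_const_zero] at h1
  rcases Nat.eq_zero_or_pos e with rfl | he
  · have h2 := weightedHomogeneousComponent_zero (w := w) (φ := Q) fun i => (hw i).ne'
    rw [IsWeightedHomogeneous.weightedHomogeneousComponent_same h, ← constantCoeff_eq, hQ0,
      C_0] at h2
    exact hQ h2
  · exact (smul_ne_zero he.ne' hQ) h1.symm

end Derivatives

section Chevalley

variable {n : ℕ} {Γ : Type*} [Group Γ]
  {ρ : Γ →* (MvPolynomial (Fin n) k →ₐ[k] MvPolynomial (Fin n) k)} [Fintype Γ] [CharZero k]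

theorem algebraicIndependent_of_irredundant {σ : Type*} [Fintype σ] [DecidableEq σ]
    (hρ : ∀ g i, (ρ g (X i)).IsHomogeneous 1)
    {S : Set Γ} (hS : Subgroup.closure S = ⊤) {α : Γ → MvPolynomial (Fin n) k}
    (hα : ∀ s ∈ S, (α s).IsHomogeneous 1) (hα0 : ∀ s ∈ S, α s ≠ 0)
    (hdvd : ∀ s ∈ S, ∀ f, α s ∣ ρ s f - f)
    {F : σ → MvPolynomial (Fin n) k} {d : σ → ℕ} (hd : ∀ i, 0 < d i)
    (hF : ∀ i, (F i).IsHomogeneous (d i)) (hfix : ∀ i, F i ∈ fixedAlg ρ)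
    (hirr : Irredundant (⊤ : Subalgebra k (MvPolynomial (Fin n) k)) F Finset.univ)
    (hspan : hilbertIdeal ρ = Ideal.span (Set.range F)) : AlgebraicIndependent k F := by
  by_contra hnot
  have hF0 : ∀ i, constantCoeff (F i) = 0 := fun i =>
    constantCoeff_eq_zero_of_isWeightedHomogeneous (hF i) (hd i).ne'
  have hfixa : ∀ Q, aeval F Q ∈ fixedAlg ρ := fun Q g => by
    rw [← AlgHom.comp_apply, comp_aeval]
    simp only [mem_fixedAlg.1 (hfix _)]
  have hex : ∃ e, ∃ Q : MvPolynomial σ k, IsWeightedHomogeneous d Q e ∧ Q ≠ 0 ∧ aeval F Q = 0 := by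
    rw [algebraicIndependent_iff] at hnot
    push Not at hnot
    obtain ⟨P, hP, hP0⟩ := hnot
    obtain ⟨e, he⟩ : ∃ e, weightedHomogeneousComponent d e P ≠ 0 := by
      by_contra! h
      refine hP0 (Submodule.mem_bot k |>.1 (mem_of_weightedHomogeneousComponent_mem d
        (⊥ : Submodule k (MvPolynomial σ k)) fun e => ?_))
      rw [h e]; exact zero_mem _
    refine ⟨e, _, weightedHomogeneousComponent_isWeightedHomogeneous e P, he, ?_⟩
    rw [← weightedHomogeneousComponent_aeval (v := 1) hF, hP, map_zero]
  classical
  obtain ⟨Q, hQ, hQne, hQ0⟩ := Nat.find_spec hex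
  have hmin := fun e => Nat.find_min hex (m := e)
  generalize Nat.find hex = e at hQ hmin
  have hQc : constantCoeff Q = 0 := by
    rw [← constantCoeff_aeval_of_forall hF0, hQ0, map_zero]
  have hder : ∀ i, IsWeightedHomogeneous d (pderiv i Q) (e - d i) := fun i => by
    rcases le_or_gt (d i) e with h | h
    · exact hQ.pderiv (Nat.sub_add_cancel h)
    · rw [IsWeightedHomogeneous.pderiv_eq_zero hQ h]; exact isWeightedHomogeneous_zero _ _ _
  obtain ⟨i₁, hi₁⟩ := exists_pderiv_ne_zero hd hQ hQne hQc
  have hH₁ : aeval F (pderiv i₁ Q) ≠ 0 := fun h => by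
    refine hmin (e - d i₁) ?_ ⟨_, hder i₁, hi₁, h⟩
    have h1 : ¬ e < d i₁ := fun h => hi₁ (IsWeightedHomogeneous.pderiv_eq_zero hQ h)
    have := hd i₁
    omega
  obtain ⟨M, -, hM, hMs⟩ := exists_irredundant (fixedAlg ρ) (fun i => aeval F (pderiv i Q))
    Finset.univ
  choose c hcR hc using fun j => hMs j (Finset.mem_univ j)
  obtain ⟨i₀, hi₀⟩ : M.Nonempty := by
    rw [Finset.nonempty_iff_ne_empty]
    rintro rfl
    exact hH₁ (by simpa using hc i₁)
  have hJ : ∀ l, pderiv l (F i₀) + ∑ j ∈ Mᶜ, c j i₀ * pderiv l (F j) ∈ hilbertIdeal ρ := fun l => by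
    refine hM.mem_hilbertIdeal hρ hS hα hα0 hdvd (d := fun i => e - d i)
      (fun i => isWeightedHomogeneous_aeval hF (hder i)) (fun i => hfixa _) hi₀
      (fun i => pderiv l (F i) + ∑ j ∈ Mᶜ, c j i * pderiv l (F j)) ?_
    have h1 := pderiv_aeval F l Q
    rw [hQ0, map_zero] at h1
    exact sum_mul_eq_zero_of_combination hc h1.symm
  simp only [hspan, Ideal.mem_span_range_iff_exists_fun] at hJ
  choose a ha using hJ
  have hEuler : ∀ i, ∑ l, X l * pderiv l (F i) = (d i : MvPolynomial (Fin n) k) * F i := fun i => by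
    rw [(hF i).sum_X_mul_pderiv, nsmul_eq_mul]
  have hrel : ∑ i, ((if i ∈ M then (if i = i₀ then (d i : MvPolynomial (Fin n) k) else 0)
      else c i i₀ * (d i : MvPolynomial (Fin n) k)) - ∑ l, X l * a l i) * F i = 0 := by
    simp only [sub_mul, Finset.sum_sub_distrib]
    rw [sub_eq_zero]
    have h1 := Finset.sum_congr rfl fun l (_ : l ∈ Finset.univ) => congrArg (X l * ·) (ha l)
    simp only [mul_add, Finset.sum_add_distrib, hEuler, Finset.mul_sum] at h1
    simp only [Finset.sum_mul, mul_assoc]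
    rw [Finset.sum_comm (γ := σ), h1, ← Finset.sum_add_sum_compl M]
    congr 1
    · rw [Finset.sum_eq_single_of_mem i₀ hi₀ fun i hiM hi => by simp [hi, hiM]]
      simp [hi₀]
    · rw [Finset.sum_comm]
      refine Finset.sum_congr rfl fun j hj => ?_
      rw [if_neg (Finset.mem_compl.1 hj), mul_assoc, ← hEuler, Finset.mul_sum]
      exact Finset.sum_congr rfl fun _ _ => mul_left_comm _ _ _
  have h1 := hirr.constantCoeff_eq_zero (fun _ _ _ => Algebra.mem_top) hF
    (fun _ => Algebra.mem_top) hrel (Finset.mem_univ i₀)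
  simp only [hi₀, if_true, map_sub, map_natCast, map_sum, map_mul, constantCoeff_X, zero_mul,
    Finset.sum_const_zero, sub_zero, Nat.cast_eq_zero] at h1
  exact (hd i₀).ne' h1

end Chevalley

section Chevalley

variable {n : ℕ} {Γ : Type*} [Group Γ]
  {ρ : Γ →* (MvPolynomial (Fin n) k →ₐ[k] MvPolynomial (Fin n) k)}

theorem exists_irredundant_generators (hρ : ∀ g i, (ρ g (X i)).IsHomogeneous 1) :
    ∃ (σ : Type) (_ : Fintype σ) (_ : DecidableEq σ) (F : σ → MvPolynomial (Fin n) k) (d : σ → ℕ),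
      (∀ i, 0 < d i) ∧ (∀ i, (F i).IsHomogeneous (d i)) ∧ (∀ i, F i ∈ fixedAlg ρ) ∧
      Irredundant (⊤ : Subalgebra k (MvPolynomial (Fin n) k)) F Finset.univ ∧
      hilbertIdeal ρ = Ideal.span (Set.range F) := by
  classical
  let H : Set (MvPolynomial (Fin n) k) :=
    {f | f ∈ fixedAlg ρ ∧ ∃ e, 0 < e ∧ f.IsHomogeneous e}
  have hH : hilbertIdeal ρ = Ideal.span H := by
    refine le_antisymm (Ideal.span_le.2 ?_) (Ideal.span_mono ?_)
    · rintro f ⟨hf, hf0⟩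
      refine mem_of_weightedHomogeneousComponent_mem 1 (Ideal.span H) fun e => ?_
      rcases Nat.eq_zero_or_pos e with rfl | he
      · have : homogeneousComponent 0 f = 0 := by
          rw [homogeneousComponent_zero, ← constantCoeff_eq, hf0, C_0]
        exact this ▸ zero_mem _
      · exact Ideal.subset_span ⟨homogeneousComponent_mem_fixedAlg hρ e f hf, e, he,
          homogeneousComponent_isHomogeneous e f⟩
    · rintro f ⟨hf, e, he, hfe⟩
      exact ⟨hf, constantCoeff_eq_zero_of_isWeightedHomogeneous hfe he.ne'⟩
  obtain ⟨T, hTH, hT⟩ := (Submodule.fg_span_iff_fg_span_finset_subset H).1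
    (IsNoetherian.noetherian (Ideal.span H))
  obtain ⟨M, hMT, hM, hMs⟩ := exists_irredundant
    (⊤ : Subalgebra k (MvPolynomial (Fin n) k)) id T
  have hMH : ∀ i : ↥M, (i : MvPolynomial (Fin n) k) ∈ H := fun i => hTH (hMT i.2)
  choose d hd hdh using fun i => (hMH i).2
  refine ⟨↥M, inferInstance, inferInstance, Subtype.val, d, hd, hdh, fun i => (hMH i).1,
    hM.subtype, ?_⟩
  rw [hH, Subtype.range_coe_subtype]
  refine le_antisymm ?_ (Ideal.span_mono fun i hi => hTH (hMT hi))
  refine hT.le.trans (Ideal.span_le.2 fun f hf => ?_)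
  obtain ⟨c, -, hc⟩ := hMs f hf
  rw [id] at hc
  rw [SetLike.mem_coe, hc]
  exact Ideal.sum_mem _ fun i hi => Ideal.mul_mem_left _ _ (Ideal.subset_span hi)

theorem isIntegral_fixedAlg [Finite Γ] :
    Algebra.IsIntegral (fixedAlg ρ) (MvPolynomial (Fin n) k) := by
  let _ : MulSemiringAction Γ (MvPolynomial (Fin n) k) :=
    { smul := fun g f => ρ g f
      one_smul := fun f => by change ρ 1 f = f; rw [map_one]; rfl
      mul_smul := fun a b f => by change ρ (a * b) f = ρ a (ρ b f); rw [map_mul]; rfl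
      smul_zero := fun g => map_zero (ρ g)
      smul_add := fun g => map_add (ρ g)
      smul_one := fun g => map_one (ρ g)
      smul_mul := fun g => map_mul (ρ g) }
  have : Algebra.IsInvariant (fixedAlg ρ) (MvPolynomial (Fin n) k) Γ :=
    ⟨fun f hf => ⟨⟨f, hf⟩, rfl⟩⟩
  exact Algebra.IsInvariant.isIntegral (fixedAlg ρ) (MvPolynomial (Fin n) k) Γ

variable [Fintype Γ] [CharZero k]

theorem adjoin_eq_fixedAlg {σ : Type*} [Fintype σ]
    (hρ : ∀ g i, (ρ g (X i)).IsHomogeneous 1)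
    {F : σ → MvPolynomial (Fin n) k} {d : σ → ℕ} (hd : ∀ i, 0 < d i)
    (hF : ∀ i, (F i).IsHomogeneous (d i)) (hfix : ∀ i, F i ∈ fixedAlg ρ)
    (hspan : hilbertIdeal ρ = Ideal.span (Set.range F)) :
    Algebra.adjoin k (Set.range F) = fixedAlg ρ := by
  refine le_antisymm (Algebra.adjoin_le (Set.range_subset_iff.2 hfix)) fun f hf => ?_
  have key : ∀ e, ∀ f ∈ fixedAlg ρ, f.IsHomogeneous e → f ∈ Algebra.adjoin k (Set.range F) := by
    intro e
    induction e using Nat.strong_induction_on with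
    | _ e ih =>
      intro f hf hfe
      rcases Nat.eq_zero_or_pos e with rfl | he
      · rw [← homogeneousComponent_of_mem hfe |>.trans (if_pos rfl), homogeneousComponent_zero]
        exact (Algebra.adjoin k _).algebraMap_mem _
      · have h1 : f ∈ hilbertIdeal ρ := Ideal.subset_span
          ⟨hf, constantCoeff_eq_zero_of_isWeightedHomogeneous hfe he.ne'⟩
        rw [hspan, Ideal.mem_span_range_iff_exists_fun] at h1
        obtain ⟨a, ha⟩ := h1
        have h2 := congrArg (fun f => homogeneousComponent e (charAvg ρ 1 f)) ha
        simp only [map_sum, charAvg_one_mul (hfix _), (isSemiInv_one_iff.2 hf).charAvg_eq] at h2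
        rw [homogeneousComponent_of_mem hfe, if_pos rfl] at h2
        rw [← h2]
        refine sum_mem fun i _ => ?_
        rw [mul_comm]
        have h3 := weightedHomogeneousComponent_mul_of_isWeightedHomogeneous (hF i)
          (charAvg ρ 1 (a i)) e
        rw [homogeneousComponent, h3]
        split_ifs with h
        · refine mul_mem (Algebra.subset_adjoin ⟨i, rfl⟩) (ih (e - d i) ?_ _ ?_ ?_)
          · have := hd i; omega
          · exact homogeneousComponent_mem_fixedAlg hρ _ _
              (isSemiInv_one_iff.1 (isSemiInv_charAvg ρ 1 _))
          · exact homogeneousComponent_isHomogeneous _ _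
        · exact zero_mem _
  exact mem_of_weightedHomogeneousComponent_mem 1 (Algebra.adjoin k (Set.range F)) fun e =>
    key e _ (homogeneousComponent_mem_fixedAlg hρ e f hf) (homogeneousComponent_isHomogeneous e f)

/-- The Chevalley–Shephard–Todd theorem: the invariants of a reflection group form a
polynomial algebra. -/
theorem exists_basic_invariants (hρ : ∀ g i, (ρ g (X i)).IsHomogeneous 1)
    {S : Set Γ} (hS : Subgroup.closure S = ⊤) {α : Γ → MvPolynomial (Fin n) k}
    (hα : ∀ s ∈ S, (α s).IsHomogeneous 1) (hα0 : ∀ s ∈ S, α s ≠ 0)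
    (hdvd : ∀ s ∈ S, ∀ f, α s ∣ ρ s f - f) :
    ∃ F : Fin n → MvPolynomial (Fin n) k, (∀ i, constantCoeff (F i) = 0) ∧
      AlgebraicIndependent k F ∧ Algebra.adjoin k (Set.range F) = fixedAlg ρ := by
  obtain ⟨σ, _, _, F, d, hd, hF, hfix, hirr, hspan⟩ := exists_irredundant_generators hρ
  have hind := algebraicIndependent_of_irredundant hρ hS hα hα0 hdvd hd hF hfix hirr hspan
  have hadj := adjoin_eq_fixedAlg hρ hd hF hfix hspan
  have hbasis : IsTranscendenceBasis k F := by
    rw [hind.isTranscendenceBasis_iff_isAlgebraic, hadj]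
    exact (isIntegral_fixedAlg (ρ := ρ)).isAlgebraic
  have hcard := hbasis.cardinalMk_eq (IsTranscendenceBasis.mvPolynomial (Fin n) k)
  rw [Cardinal.eq] at hcard
  obtain ⟨u⟩ := hcard
  refine ⟨F ∘ u.symm, fun i => constantCoeff_eq_zero_of_isWeightedHomogeneous (hF _) (hd _).ne',
    hind.comp _ u.symm.injective, ?_⟩
  rw [EquivLike.range_comp, hadj]

end Chevalley

section LinearForms

variable {σ : Type*}

theorem prime_of_isHomogeneous_one {f : MvPolynomial σ k} (hf : f.IsHomogeneous 1) (h0 : f ≠ 0) :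
    Prime f := by
  refine (irreducible_of_totalDegree_eq_one (hf.totalDegree h0) fun x hx => ?_).prime
  rw [isUnit_iff_ne_zero]
  rintro rfl
  exact h0 (ext _ _ fun i => by simpa using hx i)

theorem totalDegree_pos_of_constantCoeff_eq_zero {f : MvPolynomial σ k} (h0 : f ≠ 0)
    (hc : constantCoeff f = 0) : 0 < f.totalDegree := by
  rw [Nat.pos_iff_ne_zero]
  intro h
  rw [totalDegree_eq_zero_iff_eq_C] at h
  rw [h, ← constantCoeff_eq, hc, C_0] at h0
  exact h0 rfl

theorem exists_smul_eq_of_associated {f g : MvPolynomial σ k} (h : Associated f g) :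
    ∃ c : k, g = c • f := by
  obtain ⟨u, rfl⟩ := h
  obtain ⟨c, -, hc⟩ := isUnit_iff_eq_C_of_isReduced.1 u.isUnit
  exact ⟨c, by rw [hc, smul_eq_C_mul, mul_comm]⟩

end LinearForms

section Orbits

variable {n : ℕ} {Γ : Type} [Group Γ]
  {ρ : Γ →* (MvPolynomial (Fin n) k →ₐ[k] MvPolynomial (Fin n) k)}

theorem map_mul_apply (a b : Γ) (f : MvPolynomial (Fin n) k) : ρ (a * b) f = ρ a (ρ b f) := by
  rw [map_mul]; rfl

theorem map_inv_apply_map (a : Γ) (f : MvPolynomial (Fin n) k) : ρ a⁻¹ (ρ a f) = f := by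
  rw [← map_mul_apply, inv_mul_cancel, map_one]; rfl

theorem map_apply_map_inv (a : Γ) (f : MvPolynomial (Fin n) k) : ρ a (ρ a⁻¹ f) = f := by
  rw [← map_mul_apply, mul_inv_cancel, map_one]; rfl

/-- The product of the distinct classes of linear forms in the orbit of `β`. -/
theorem exists_orbit_product [Finite Γ] (hρ : ∀ g i, (ρ g (X i)).IsHomogeneous 1)
    {β : MvPolynomial (Fin n) k} (hβ : β.IsHomogeneous 1) (hβ0 : β ≠ 0) :
    ∃ (y : MvPolynomial (Fin n) k) (θ : Γ →* kˣ), y ≠ 0 ∧ IsSemiInv ρ θ y ∧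
      (∀ w, ρ w β ∣ y) ∧ (∀ f, (∀ w, ρ w β ∣ f) → y ∣ f) ∧
      ∀ p, Prime p → p ∣ y → ∃ w, Associated p (ρ w β) := by
  classical
  cases nonempty_fintype Γ
  have hne : ∀ w, ρ w β ≠ 0 := fun w h => hβ0 (by
    rw [← map_inv_apply_map (ρ := ρ) w β, h, map_zero])
  have hprime : ∀ w, Prime (ρ w β) := fun w =>
    prime_of_isHomogeneous_one (isHomogeneous_map hρ w hβ) (hne w)
  let O : Finset (Associates (MvPolynomial (Fin n) k)) :=
    Finset.univ.image fun w => Associates.mk (ρ w β)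
  have hO : ∀ w, Associates.mk (ρ w β) ∈ O := fun w => Finset.mem_image_of_mem _ (Finset.mem_univ w)
  have hOprime : ∀ a ∈ O, Prime a := fun a ha => by
    obtain ⟨w, -, rfl⟩ := Finset.mem_image.1 ha
    exact Associates.prime_mk.2 (hprime w)
  obtain ⟨y, hy⟩ := Associates.mk_surjective (∏ a ∈ O, a)
  have hy0 : y ≠ 0 := by
    rw [← Associates.mk_ne_zero, hy, Finset.prod_ne_zero_iff]
    exact fun a ha => (hOprime a ha).ne_zero
  have hdvd : ∀ w, ρ w β ∣ y := fun w => by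
    rw [← Associates.mk_dvd_mk, hy]
    exact Finset.dvd_prod_of_mem _ (hO w)
  have hmin : ∀ f, (∀ w, ρ w β ∣ f) → y ∣ f := fun f hf => by
    rw [← Associates.mk_dvd_mk, hy]
    refine Finset.prod_primes_dvd _ hOprime fun a ha => ?_
    obtain ⟨w, -, rfl⟩ := Finset.mem_image.1 ha
    exact Associates.mk_dvd_mk.2 (hf w)
  have hstab : ∀ w, y ∣ ρ w y := fun w => hmin _ fun v => by
    have h := map_dvd (ρ w) (hdvd (w⁻¹ * v))
    rwa [← map_mul_apply, mul_inv_cancel_left] at h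
  obtain ⟨θ, hθ⟩ := exists_isSemiInv ρ hy0 fun w => by
    refine exists_smul_eq_of_associated (associated_of_dvd_dvd (hstab w) ?_)
    have h := map_dvd (ρ w) (hstab w⁻¹)
    rwa [map_apply_map_inv] at h
  refine ⟨y, θ, hy0, hθ, hdvd, hmin, fun p hp hpy => ?_⟩
  rw [← Associates.mk_dvd_mk, hy] at hpy
  obtain ⟨a, ha, hpa⟩ := (Associates.prime_mk.2 hp).exists_mem_finset_dvd hpy
  obtain ⟨w, -, rfl⟩ := Finset.mem_image.1 ha
  exact ⟨w, hp.associated_of_dvd (hprime w) (Associates.mk_dvd_mk.1 hpa)⟩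

theorem IsSemiInv.dvd_of_apply_ne_one {χ : Γ →* kˣ} {f : MvPolynomial (Fin n) k}
    (hf : IsSemiInv ρ χ f) {s : Γ} (hs : χ s ≠ 1) {β : MvPolynomial (Fin n) k}
    (hβ : β ∣ ρ s f - f) (w : Γ) : ρ w β ∣ f := by
  have h1 : ((χ s : k) - 1) ≠ 0 := sub_ne_zero.2 (by simpa using hs)
  have h2 : β ∣ f := by
    have h := hβ
    rw [hf s, show (χ s : k) • f - f = ((χ s : k) - 1) • f by rw [sub_smul, one_smul],
      smul_eq_C_mul] at h
    exact ((isUnit_iff_ne_zero.2 h1).map C).dvd_mul_left.1 h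
  have h3 := map_dvd (ρ w) h2
  rw [hf w, smul_eq_C_mul] at h3
  exact ((χ w).isUnit.map C).dvd_mul_left.1 h3

theorem exists_orbit_semiInvariants [Finite Γ] (hρ : ∀ g i, (ρ g (X i)).IsHomogeneous 1)
    {S : Set Γ} (hS : Subgroup.closure S = ⊤) {α : Γ → MvPolynomial (Fin n) k}
    (hα : ∀ s ∈ S, (α s).IsHomogeneous 1) (hα0 : ∀ s ∈ S, α s ≠ 0)
    (hdvd : ∀ s ∈ S, ∀ f, α s ∣ ρ s f - f) :
    ∃ (ι : Type) (_ : Fintype ι) (y : ι → MvPolynomial (Fin n) k) (θ : ι → Γ →* kˣ),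
      (∀ c, y c ≠ 0) ∧ (∀ c, constantCoeff (y c) = 0) ∧ (∀ c, IsSemiInv ρ (θ c) (y c)) ∧
      (∀ a : ι → ℤ, (∀ g, ∏ c, θ c g ^ a c = 1) → ∀ c g, θ c g ^ a c = 1) ∧
      ∀ f χ, IsSemiInv ρ χ f → f ∉ fixedAlg ρ → ∃ c, y c ∣ f := by
  classical
  have hext : ∀ χ : Γ →* kˣ, (∀ s ∈ S, χ s = 1) → χ = 1 := fun χ h =>
    MonoidHom.eq_of_eqOn_dense hS fun s hs => h s hs
  have hex := fun s : S => exists_orbit_product hρ (hα s s.2) (hα0 s s.2)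
  choose Y Θ hY0 hΘ hYdvd hYmin hYprime using hex
  let r : Setoid S :=
    { r := fun s t => ∃ w, Associated (α s) (ρ w (α t))
      iseqv :=
        { refl := fun s => ⟨1, by rw [map_one]; exact Associated.refl _⟩
          symm := fun {s t} ⟨w, h⟩ => ⟨w⁻¹, by
            simpa [map_inv_apply_map] using (h.map (ρ w⁻¹)).symm⟩
          trans := fun {s t u} ⟨w, h⟩ ⟨v, h'⟩ => ⟨w * v, by
            rw [map_mul_apply]; exact h.trans (h'.map (ρ w))⟩ } }
  have hsame : ∀ s t : S, r s t → ∀ f, Y t ∣ f ↔ ∀ w, ρ w (α s) ∣ f := fun s t ⟨v, h⟩ f => by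
    constructor
    · intro hf w
      have h1 := h.map (ρ w)
      rw [← map_mul_apply] at h1
      exact h1.dvd.trans ((hYdvd t _).trans hf)
    · intro hf
      refine hYmin t f fun w => ?_
      have h1 := h.map (ρ (w * v⁻¹))
      rw [← map_mul_apply, inv_mul_cancel_right] at h1
      exact h1.symm.dvd.trans (hf _)
  have hone : ∀ s t : S, ¬ r s t → Θ t s = 1 := fun s t hst => by
    by_contra h
    have h1 := (hΘ t).dvd_of_apply_ne_one h (hdvd s s.2 _) 1
    rw [map_one, AlgHom.one_apply] at h1
    exact hst (hYprime t _ (prime_of_isHomogeneous_one (hα s s.2) (hα0 s s.2)) h1)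
  refine ⟨Quotient r, Fintype.ofFinite _, fun c => Y c.out, fun c => Θ c.out, fun c => hY0 _,
    fun c => ?_, fun c => hΘ _, fun a ha c => ?_, fun f χ hf hfix => ?_⟩
  · obtain ⟨g, hg⟩ := hYdvd c.out 1
    rw [map_one, AlgHom.one_apply] at hg
    change constantCoeff (Y c.out) = 0
    rw [hg, map_mul, constantCoeff_eq_zero_of_isWeightedHomogeneous (hα _ c.out.2) one_ne_zero,
      zero_mul]
  · suffices h : (zpowGroupHom (a c)).comp (Θ c.out) = 1 from fun g => DFunLike.congr_fun h g
    refine hext _ fun s hs => ?_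
    change Θ c.out s ^ a c = 1
    by_cases hc : r ⟨s, hs⟩ c.out
    · rw [← ha s]
      symm
      refine Finset.prod_eq_single c (fun c' _ hc' => ?_) (by simp)
      rw [hone ⟨s, hs⟩ _ fun h => hc' ?_, one_zpow]
      rw [← Quotient.out_eq c, ← Quotient.out_eq c']
      exact Quotient.sound (r.trans (r.symm h) hc)
    · rw [hone ⟨s, hs⟩ _ hc, one_zpow]
  · obtain ⟨s, hs, hχ⟩ : ∃ s ∈ S, χ s ≠ 1 := by
      by_contra! h
      exact hfix (isSemiInv_one_iff.1 (hext χ h ▸ hf))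
    refine ⟨Quotient.mk r ⟨s, hs⟩, (hsame ⟨s, hs⟩ _ ?_ f).2
      (hf.dvd_of_apply_ne_one hχ (hdvd s hs f))⟩
    exact r.symm (Quotient.mk_out (s := r) ⟨s, hs⟩)

theorem IsSemiInv.mem_adjoin {σ ι : Type*} {F : σ → MvPolynomial (Fin n) k}
    {y : ι → MvPolynomial (Fin n) k} {θ : ι → Γ →* kˣ}
    (hF : Algebra.adjoin k (Set.range F) = fixedAlg ρ) (hy0 : ∀ c, y c ≠ 0)
    (hyc : ∀ c, constantCoeff (y c) = 0) (hy : ∀ c, IsSemiInv ρ (θ c) (y c))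
    (hdvd : ∀ f χ, IsSemiInv ρ χ f → f ∉ fixedAlg ρ → ∃ c, y c ∣ f)
    {f : MvPolynomial (Fin n) k} {χ : Γ →* kˣ} (hf : IsSemiInv ρ χ f) :
    f ∈ Algebra.adjoin k (Set.range (Sum.elim F y)) := by
  induction hN : f.totalDegree using Nat.strong_induction_on generalizing f χ with
  | _ N ih =>
    by_cases h0 : f = 0
    · rw [h0]; exact zero_mem _
    by_cases hfix : f ∈ fixedAlg ρ
    · rw [← hF] at hfix
      refine Algebra.adjoin_mono ?_ hfix
      rintro _ ⟨i, rfl⟩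
      exact ⟨Sum.inl i, rfl⟩
    obtain ⟨c, g, rfl⟩ := hdvd f χ hf hfix
    have hg0 : g ≠ 0 := right_ne_zero_of_mul h0
    have hg : IsSemiInv ρ (χ * (θ c)⁻¹) g := fun w => by
      have h1 := hf w
      rw [map_mul, hy c w, smul_mul_assoc, ← mul_smul_comm, ← mul_smul_comm] at h1
      have h2 := mul_left_cancel₀ (hy0 c) h1
      rw [MonoidHom.mul_apply, MonoidHom.inv_apply, mul_comm, Units.val_mul, mul_smul, ← h2,
        smul_smul, ← Units.val_mul, inv_mul_cancel, Units.val_one, one_smul]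
    refine mul_mem (Algebra.subset_adjoin ⟨Sum.inr c, rfl⟩) (ih _ ?_ hg rfl)
    rw [← hN, totalDegree_mul_of_isDomain (hy0 c) hg0]
    have := totalDegree_pos_of_constantCoeff_eq_zero (hy0 c) (hyc c)
    omega

end Orbits

section Eigenvectors

/-- If `T ^ o` fixes `f` and `k` contains a primitive `o`-th root of unity, then `f` is a sum of
eigenvectors of `T`. -/
theorem mem_span_eigenvectors [CharZero k] {M : Type*} [AddCommGroup M] [Module k M]
    {T : Module.End k M} {P : Submodule k M} (hP : ∀ x ∈ P, T x ∈ P) {ζ : k} {o : ℕ}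
    (hζ : IsPrimitiveRoot ζ o) (ho : o ≠ 0) {f : M} (hfP : f ∈ P) (hf : (T ^ o) f = f) :
    f ∈ Submodule.span k {h | h ∈ P ∧ ∃ a : k, T h = a • h} := by
  have hη := hζ.inv
  set η := ζ⁻¹
  have hTP : ∀ i, (T ^ i) f ∈ P := fun i => by
    induction i with
    | zero => simpa using hfP
    | succ i ih => rw [pow_succ', Module.End.mul_apply]; exact hP _ ih
  let h : ℕ → M := fun j => ∑ i ∈ Finset.range o, η ^ (i * j) • (T ^ i) f
  have hmem : ∀ j, h j ∈ P := fun j =>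
    P.sum_mem fun i _ => P.smul_mem _ (hTP i)
  have hTh : ∀ j, η ^ j • T (h j) = h j := fun j => by
    have h1 : η ^ j • T (h j) =
        ∑ i ∈ Finset.range o, η ^ ((i + 1) * j) • (T ^ (i + 1)) f := by
      simp only [h, map_sum, Finset.smul_sum, map_smul, smul_smul]
      refine Finset.sum_congr rfl fun i _ => ?_
      rw [pow_succ' T, Module.End.mul_apply, ← pow_add]
      congr 2
      ring
    rw [h1]
    have h2 := Finset.sum_range_succ (fun i => η ^ (i * j) • (T ^ i) f) o
    rw [Finset.sum_range_succ' (fun i => η ^ (i * j) • (T ^ i) f) o] at h2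
    have h3 : η ^ (o * j) • (T ^ o) f = η ^ (0 * j) • (T ^ 0) f := by
      rw [hf, pow_mul, hη.pow_eq_one]
      simp
    rw [h3] at h2
    exact add_right_cancel h2
  have hsum : ∑ j ∈ Finset.range o, h j = (o : k) • f := by
    simp only [h]
    rw [Finset.sum_comm, Finset.sum_eq_single 0]
    · simp [Nat.cast_smul_eq_nsmul]
    · intro i hi hi0
      rw [← Finset.sum_smul]
      have h1 : η ^ i - 1 ≠ 0 := sub_ne_zero.2
        (hη.pow_ne_one_of_pos_of_lt hi0 (Finset.mem_range.1 hi))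
      have h2 : ∑ j ∈ Finset.range o, η ^ (i * j) = 0 := by
        refine (mul_eq_zero.1 ?_).resolve_right h1
        simp only [pow_mul]
        rw [geom_sum_mul, ← pow_mul, mul_comm, pow_mul, hη.pow_eq_one, one_pow, sub_self]
      rw [h2, zero_smul]
    · simp [ho]
  have ho' : (o : k) ≠ 0 := Nat.cast_ne_zero.2 ho
  rw [show f = (o : k)⁻¹ • ∑ j ∈ Finset.range o, h j by
    rw [hsum, smul_smul, inv_mul_cancel₀ ho', one_smul]]
  refine Submodule.smul_mem _ _ (Submodule.sum_mem _ fun j _ => Submodule.subset_span ⟨hmem j, ?_⟩)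
  have hη0 : η ^ j ≠ 0 := pow_ne_zero _ (hη.ne_zero ho)
  exact ⟨(η ^ j)⁻¹, by rw [eq_inv_smul_iff₀ hη0, hTh]⟩

end Eigenvectors

section CommFixed

variable {n : ℕ} {Γ : Type} [Group Γ]
  {ρ : Γ →* (MvPolynomial (Fin n) k →ₐ[k] MvPolynomial (Fin n) k)}

/-- The elements on which the group acts through its abelianization. -/
def commFixed (ρ : Γ →* (MvPolynomial (Fin n) k →ₐ[k] MvPolynomial (Fin n) k)) :
    Subalgebra k (MvPolynomial (Fin n) k) where
  carrier := {f | ∀ g h, ρ (g * h) f = ρ (h * g) f}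
  mul_mem' := fun ha hb g h => by
    rw [map_mul (ρ _), ha g h, hb g h, ← map_mul (ρ _)]
  add_mem' := fun ha hb g h => by rw [map_add (ρ _), ha g h, hb g h, map_add]
  algebraMap_mem' := fun r g h => by rw [AlgHom.commutes, AlgHom.commutes]

theorem mem_commFixed {f : MvPolynomial (Fin n) k} :
    f ∈ commFixed ρ ↔ ∀ g h, ρ (g * h) f = ρ (h * g) f :=
  Iff.rfl

theorem IsSemiInv.mem_commFixed {χ : Γ →* kˣ} {f : MvPolynomial (Fin n) k}
    (hf : IsSemiInv ρ χ f) : f ∈ commFixed ρ := fun g h => by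
  rw [hf, hf, map_mul, map_mul, mul_comm]

theorem apply_mem_commFixed {f : MvPolynomial (Fin n) k} (hf : f ∈ commFixed ρ) (w : Γ) :
    ρ w f ∈ commFixed ρ := fun g h => by
  rw [← map_mul_apply, ← map_mul_apply, mul_assoc, hf g, mul_assoc, mul_assoc, map_mul_apply,
    hf w g, ← map_mul_apply]

/-- An element of finite order fixing `α` and acting trivially modulo `α` is trivial. -/
theorem apply_eq_of_dvd_of_apply_eq [CharZero k] [Finite Γ] {t : Γ} {α : MvPolynomial (Fin n) k}
    (hα : ρ t α = α) (hdvd : ∀ f, α ∣ ρ t f - f) (hρ : ∀ g i, (ρ g (X i)).IsHomogeneous 1)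
    (h1 : α.IsHomogeneous 1) (h0 : α ≠ 0) : ρ t = 1 := by
  refine algHom_ext fun i => ?_
  obtain ⟨q, hq⟩ := hdvd (X i)
  have hhom : (α * q).IsHomogeneous 1 := hq ▸ (hρ t i).sub (isHomogeneous_X k i)
  by_cases hq0 : q = 0
  · rw [hq0, mul_zero, sub_eq_zero] at hq
    exact hq
  exfalso
  have hdeg : q.totalDegree = 0 := by
    have h2 := hhom.totalDegree (mul_ne_zero h0 hq0)
    rw [totalDegree_mul_of_isDomain h0 hq0, h1.totalDegree h0] at h2
    omega
  have hC := totalDegree_eq_zero_iff_eq_C.1 hdeg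
  have hfix : ρ t (α * q) = α * q := by
    rw [hC, map_mul, hα, ← algebraMap_eq, AlgHom.commutes]
  have hpow : ∀ N : ℕ, ρ (t ^ N) (X i) = X i + (N : MvPolynomial (Fin n) k) * (α * q) := fun N => by
    induction N with
    | zero => simp
    | succ N ih =>
      rw [pow_succ', map_mul_apply, ih, map_add, map_mul, hfix, map_natCast,
        eq_add_of_sub_eq hq]
      push_cast
      ring
  have h3 := hpow (orderOf t)
  rw [pow_orderOf_eq_one, map_one, AlgHom.one_apply, left_eq_add, mul_eq_zero] at h3
  refine h3.elim (fun h => (orderOf_pos t).ne' ?_) (mul_ne_zero h0 hq0)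
  exact_mod_cast h

theorem exists_isPrimitiveRoot_of_dvd [CharZero k] [Finite Γ]
    (hρ : ∀ g i, (ρ g (X i)).IsHomogeneous 1) {s : Γ} {α : MvPolynomial (Fin n) k}
    (hα : α.IsHomogeneous 1) (hα0 : α ≠ 0) (hdvd : ∀ f, α ∣ ρ s f - f) :
    ∃ (ζ : k) (o : ℕ), o ≠ 0 ∧ IsPrimitiveRoot ζ o ∧ ρ (s ^ o) = 1 := by
  have hs0 : ρ s α ≠ 0 := fun h => hα0 (by rw [← map_inv_apply_map (ρ := ρ) s α, h, map_zero])
  have h1 : α ∣ ρ s α := by simpa using dvd_add (hdvd α) (dvd_refl α)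
  obtain ⟨ζ, hζ⟩ := exists_smul_eq_of_associated
    ((prime_of_isHomogeneous_one hα hα0).associated_of_dvd
    (prime_of_isHomogeneous_one (isHomogeneous_map hρ s hα) hs0) h1)
  have hpow : ∀ N : ℕ, ρ (s ^ N) α = ζ ^ N • α := fun N => by
    induction N with
    | zero => simp
    | succ N ih => rw [pow_succ', map_mul_apply, ih, map_smul, hζ, smul_smul, pow_succ]
  have hdvdpow : ∀ (N : ℕ) f, α ∣ ρ (s ^ N) f - f := fun N f => by
    induction N with
    | zero => simp
    | succ N ih =>
      have h := dvd_add (hdvd (ρ (s ^ N) f)) ih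
      rwa [← map_mul_apply, ← pow_succ', sub_add_sub_cancel] at h
  have hfin : IsOfFinOrder ζ := by
    refine isOfFinOrder_iff_pow_eq_one.2 ⟨orderOf s, orderOf_pos s, ?_⟩
    have h := hpow (orderOf s)
    rw [pow_orderOf_eq_one, map_one, AlgHom.one_apply] at h
    refine smul_left_injective k hα0 ?_
    simp only [← h, one_smul]
  refine ⟨ζ, orderOf ζ, hfin.orderOf_pos.ne', IsPrimitiveRoot.orderOf ζ, ?_⟩
  refine apply_eq_of_dvd_of_apply_eq ?_ (hdvdpow _) hρ hα hα0
  rw [hpow, pow_orderOf_eq_one, one_smul]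

theorem mem_span_of_mem_commFixed [CharZero k] {S : Finset Γ}
    (hS : ∀ s ∈ S, ∃ (ζ : k) (o : ℕ), o ≠ 0 ∧ IsPrimitiveRoot ζ o ∧ ρ (s ^ o) = 1)
    {f : MvPolynomial (Fin n) k} (hf : f ∈ commFixed ρ) :
    f ∈ Submodule.span k {h | h ∈ commFixed ρ ∧ ∀ s ∈ S, ∃ a : k, ρ s h = a • h} := by
  classical
  induction S using Finset.induction_on with
  | empty => exact Submodule.subset_span ⟨hf, by simp⟩
  | insert s S _ ih =>
    refine Submodule.span_le.2 ?_ (ih fun t ht => hS t (Finset.mem_insert_of_mem ht))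
    rintro h ⟨hh, hS'⟩
    choose! a ha using hS'
    obtain ⟨ζ, o, ho, hζ, hs⟩ := hS s (Finset.mem_insert_self s S)
    let P : Submodule k (MvPolynomial (Fin n) k) :=
      (commFixed ρ).toSubmodule ⊓ ⨅ t ∈ S, LinearMap.ker ((ρ t).toLinearMap - a t • LinearMap.id)
    have hP : ∀ x, x ∈ P ↔ x ∈ commFixed ρ ∧ ∀ t ∈ S, ρ t x = a t • x := fun x => by
      simp [P, sub_eq_zero]
    have hmem := mem_span_eigenvectors (T := (ρ s).toLinearMap) (P := P) (fun x hx => ?_) hζ ho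
      ((hP h).2 ⟨hh, ha⟩) ?_
    · refine Submodule.span_mono ?_ hmem
      rintro x ⟨hx, b, hb⟩
      refine ⟨((hP x).1 hx).1, fun t ht => ?_⟩
      rcases Finset.mem_insert.1 ht with rfl | ht
      · exact ⟨b, hb⟩
      · exact ⟨a t, ((hP x).1 hx).2 t ht⟩
    · obtain ⟨hx, hx'⟩ := (hP x).1 hx
      refine (hP _).2 ⟨apply_mem_commFixed hx s, fun t ht => ?_⟩
      rw [AlgHom.toLinearMap_apply, ← map_mul_apply, hx t s, map_mul_apply, hx' t ht, map_smul]
    · have hpow : ∀ N : ℕ, ((ρ s).toLinearMap ^ N) h = ρ (s ^ N) h := fun N => by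
        induction N with
        | zero => simp
        | succ N ih => rw [pow_succ', Module.End.mul_apply, ih, pow_succ', map_mul_apply]; rfl
      rw [hpow, hs, AlgHom.one_apply]

theorem exists_smul_of_closure_eq_top {S : Set Γ} (hS : Subgroup.closure S = ⊤)
    {f : MvPolynomial (Fin n) k} (hf : ∀ s ∈ S, ∃ a : k, ρ s f = a • f) (w : Γ) :
    ∃ a : k, ρ w f = a • f := by
  have hw : w ∈ Subgroup.closure S := hS ▸ Subgroup.mem_top w
  induction hw using Subgroup.closure_induction with
  | mem s hs => exact hf s hs
  | one => exact ⟨1, by simp⟩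
  | mul v w _ _ hv hw =>
    obtain ⟨a, ha⟩ := hv
    obtain ⟨b, hb⟩ := hw
    exact ⟨b * a, by rw [map_mul_apply, hb, map_smul, ha, smul_smul]⟩
  | inv w _ hw =>
    obtain ⟨a, ha⟩ := hw
    by_cases ha0 : a = 0
    · have h0 : f = 0 := by
        rw [← map_inv_apply_map (ρ := ρ) w f, ha, ha0, zero_smul, map_zero]
      exact ⟨0, by simp [h0]⟩
    · refine ⟨a⁻¹, ?_⟩
      rw [eq_inv_smul_iff₀ ha0, ← map_smul, ← ha, map_inv_apply_map]

theorem adjoin_sumElim_eq_commFixed [CharZero k] [Finite Γ]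
    (hρ : ∀ g i, (ρ g (X i)).IsHomogeneous 1)
    {S : Set Γ} (hS : Subgroup.closure S = ⊤) {α : Γ → MvPolynomial (Fin n) k}
    (hα : ∀ s ∈ S, (α s).IsHomogeneous 1) (hα0 : ∀ s ∈ S, α s ≠ 0)
    (hdvd : ∀ s ∈ S, ∀ f, α s ∣ ρ s f - f)
    {σ ι : Type*} {F : σ → MvPolynomial (Fin n) k}
    {y : ι → MvPolynomial (Fin n) k} {θ : ι → Γ →* kˣ}
    (hF : Algebra.adjoin k (Set.range F) = fixedAlg ρ) (hy0 : ∀ c, y c ≠ 0)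
    (hyc : ∀ c, constantCoeff (y c) = 0) (hy : ∀ c, IsSemiInv ρ (θ c) (y c))
    (hydvd : ∀ f χ, IsSemiInv ρ χ f → f ∉ fixedAlg ρ → ∃ c, y c ∣ f) :
    Algebra.adjoin k (Set.range (Sum.elim F y)) = commFixed ρ := by
  refine le_antisymm (Algebra.adjoin_le ?_) fun f hf => ?_
  · rintro _ ⟨i | c, rfl⟩
    · have hi : F i ∈ fixedAlg ρ := hF ▸ Algebra.subset_adjoin ⟨i, rfl⟩
      exact (isSemiInv_one_iff.2 hi).mem_commFixed
    · exact (hy c).mem_commFixed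
  · have hS' : S.Finite := S.toFinite
    have h := mem_span_of_mem_commFixed (S := hS'.toFinset) (fun s hs => ?_) hf
    · rw [← Subalgebra.mem_toSubmodule]
      refine Submodule.span_le.2 ?_ h
      rintro g ⟨-, hg⟩
      by_cases hg0 : g = 0
      · rw [hg0]; exact zero_mem _
      obtain ⟨χ, hχ⟩ := exists_isSemiInv ρ hg0
        (exists_smul_of_closure_eq_top hS fun s hs => hg s (hS'.mem_toFinset.2 hs))
      exact hχ.mem_adjoin hF hy0 hyc hy hydvd
    · have hs' := hS'.mem_toFinset.1 hs
      exact exists_isPrimitiveRoot_of_dvd hρ (hα s hs') (hα0 s hs') (hdvd s hs')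

end CommFixed

section Matrices

open scoped commutatorElement

variable {n : ℕ}

theorem matAct_X (g : Matrix.GeneralLinearGroup (Fin n) k) (i : Fin n) :
    matAct g (X i) = ∑ j, ((↑(g⁻¹) : Matrix (Fin n) (Fin n) k) i j) • X j :=
  aeval_X _ _

/-- The action of the general linear group on polynomials, as a homomorphism. -/
def matActHom (k : Type) [Field k] (n : ℕ) : Matrix.GeneralLinearGroup (Fin n) k →*
    (MvPolynomial (Fin n) k →ₐ[k] MvPolynomial (Fin n) k) where
  toFun := matAct
  map_one' := algHom_ext fun i => by
    simp [matAct_X, Matrix.one_apply]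
  map_mul' g h := algHom_ext fun i => by
    rw [AlgHom.mul_apply, matAct_X, matAct_X, map_sum]
    simp only [map_smul, matAct_X, mul_inv_rev, Units.val_mul, Matrix.mul_apply, Finset.sum_smul,
      Finset.smul_sum, smul_smul]
    exact Finset.sum_comm

theorem isHomogeneous_sum_smul_X {σ : Type*} [Fintype σ] (a : σ → k) :
    (∑ j, a j • (X j : MvPolynomial σ k)).IsHomogeneous 1 :=
  IsHomogeneous.sum _ _ _ fun j _ => by
    rw [smul_eq_C_mul]
    simpa using (isHomogeneous_C σ (a j)).mul (isHomogeneous_X k j)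

theorem isHomogeneous_matAct_X (g : Matrix.GeneralLinearGroup (Fin n) k) (i : Fin n) :
    (matAct g (X i)).IsHomogeneous 1 := by
  rw [matAct_X]
  exact isHomogeneous_sum_smul_X _

theorem dvd_sub_of_dvd_X_sub {σ : Type*} {π : MvPolynomial σ k →ₐ[k] MvPolynomial σ k}
    {α : MvPolynomial σ k} (h : ∀ i, α ∣ π (X i) - X i) (f : MvPolynomial σ k) :
    α ∣ π f - f := by
  induction f using MvPolynomial.induction_on with
  | C a => rw [← algebraMap_eq, AlgHom.commutes, sub_self]; exact dvd_zero _
  | add f g hf hg => rw [map_add, add_sub_add_comm]; exact dvd_add hf hg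
  | mul_X f i hf =>
    rw [map_mul, show π f * π (X i) - f * X i = (π f - f) * π (X i) + f * (π (X i) - X i) by ring]
    exact dvd_add (hf.mul_right _) ((h i).mul_left _)

theorem exists_smul_eq_of_finrank_eq_one {V : Type*} [AddCommGroup V] [Module k V]
    {D : Submodule k V} (h : Module.finrank k D = 1) :
    ∃ φ : V, φ ≠ 0 ∧ ∀ ψ ∈ D, ∃ a : k, ψ = a • φ := by
  obtain ⟨φ, hφ0, hφ⟩ := finrank_eq_one_iff'.1 h
  refine ⟨φ, by simpa using hφ0, fun ψ hψ => ?_⟩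
  obtain ⟨a, ha⟩ := hφ ⟨ψ, hψ⟩
  exact ⟨a, (congrArg Subtype.val ha).symm⟩

/-- A reflection acts trivially modulo a linear form. -/
theorem IsReflection.exists_dvd_sub {g : Matrix.GeneralLinearGroup (Fin n) k}
    (hg : IsReflection (g : Matrix (Fin n) (Fin n) k)) :
    ∃ α : MvPolynomial (Fin n) k, α.IsHomogeneous 1 ∧ α ≠ 0 ∧ ∀ f, α ∣ matAct g f - f := by
  obtain ⟨-, hrank⟩ := hg
  set H := LinearMap.ker (Matrix.toLin' (g : Matrix (Fin n) (Fin n) k) - LinearMap.id)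
  have h1 : Module.finrank k H.dualAnnihilator = 1 := by
    have h2 := Subspace.finrank_add_finrank_dualAnnihilator_eq H
    rw [Module.finrank_fin_fun] at h2
    omega
  obtain ⟨φ, hφ0, hφ⟩ := exists_smul_eq_of_finrank_eq_one
    (V := (Fin n → k) →ₗ[k] k) (D := H.dualAnnihilator) h1
  refine ⟨∑ j, φ (Pi.single j 1) • X j, isHomogeneous_sum_smul_X _, fun h => hφ0 ?_,
    dvd_sub_of_dvd_X_sub fun i => ?_⟩
  · refine LinearMap.pi_ext' fun j => LinearMap.ext_ring ?_
    have h2 := congrArg (linCoeff j) h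
    simp only [map_sum, map_smul, linCoeff_X, map_zero] at h2
    simpa using h2
  · let ψ : Module.Dual k (Fin n → k) := LinearMap.proj i ∘ₗ
      (Matrix.toLin' (↑(g⁻¹) : Matrix (Fin n) (Fin n) k) - LinearMap.id)
    have hψ : ψ ∈ H.dualAnnihilator := by
      rw [Submodule.mem_dualAnnihilator]
      intro v hv
      have hv' : Matrix.mulVec (g : Matrix (Fin n) (Fin n) k) v = v := by
        simpa [H, sub_eq_zero] using hv
      have hv2 : Matrix.mulVec (↑(g⁻¹) : Matrix (Fin n) (Fin n) k) v = v := by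
        conv_lhs => rw [← hv']
        rw [Matrix.mulVec_mulVec, ← Units.val_mul, inv_mul_cancel, Units.val_one, Matrix.one_mulVec]
      change Matrix.mulVec (↑(g⁻¹) : Matrix (Fin n) (Fin n) k) v i - v i = 0
      rw [hv2, sub_self]
    obtain ⟨a, ha⟩ := hφ ψ hψ
    have hX : matAct g (X i) - X i = ∑ j, ψ (Pi.single j 1) • X j := by
      rw [matAct_X]
      have h2 : ∀ j, ψ (Pi.single j 1) =
          (↑(g⁻¹) : Matrix (Fin n) (Fin n) k) i j - (1 : Matrix (Fin n) (Fin n) k) i j :=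
        fun j => by
        change Matrix.mulVec (↑(g⁻¹) : Matrix (Fin n) (Fin n) k) (Pi.single j 1) i -
          (Pi.single j 1 : Fin n → k) i = _
        rw [Matrix.mulVec_single_one, Matrix.one_apply, Pi.single_apply, Matrix.col_apply]
      simp only [h2, sub_smul, Finset.sum_sub_distrib]
      congr 1
      simp [Matrix.one_apply]
    rw [hX, ha]
    simp only [LinearMap.smul_apply, smul_assoc, ← Finset.smul_sum]
    rw [smul_eq_C_mul]
    exact dvd_mul_left _ _

/-- The action of a subgroup of the general linear group on polynomials. -/
def subgroupAct (W : Subgroup (Matrix.GeneralLinearGroup (Fin n) k)) :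
    ↥W →* (MvPolynomial (Fin n) k →ₐ[k] MvPolynomial (Fin n) k) :=
  (matActHom k n).comp W.subtype

theorem IsReflectionGroup.closure_eq_top {W : Subgroup (Matrix.GeneralLinearGroup (Fin n) k)}
    (hW : IsReflectionGroup W) :
    Subgroup.closure {w : ↥W | IsReflection
      ((w : Matrix.GeneralLinearGroup (Fin n) k) : Matrix (Fin n) (Fin n) k)} = ⊤ := by
  refine Subgroup.map_injective W.subtype_injective ?_
  rw [MonoidHom.map_closure, ← MonoidHom.range_eq_map, Subgroup.range_subtype]
  refine Eq.trans (congrArg _ ?_) hW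
  ext g
  simp [and_comm]

theorem invariants_commutator (W : Subgroup (Matrix.GeneralLinearGroup (Fin n) k)) :
    invariants ⁅W, W⁆ = commFixed (subgroupAct W) := by
  ext f
  constructor
  · intro hf g h
    have h1 := hf _ (Subgroup.commutator_mem_commutator (inv_mem g.2) (inv_mem h.2))
    have h2 : g * h = h * g * ⁅g⁻¹, h⁻¹⁆ := by
      rw [commutatorElement_def]; group
    rw [h2, map_mul_apply]
    exact congrArg _ h1
  · intro hf g hg
    let K : Subgroup (Matrix.GeneralLinearGroup (Fin n) k) :=
      { carrier := {g | matActHom k n g f = f}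
        one_mem' := by simp
        mul_mem' := fun {a b} ha hb => by
          change matActHom k n (a * b) f = f
          rw [map_mul_apply, hb, ha]
        inv_mem' := fun {a} ha => by
          change matActHom k n a⁻¹ f = f
          conv_lhs => rw [← show matActHom k n a f = f from ha]
          exact map_inv_apply_map a f }
    refine (Subgroup.commutator_le (H₃ := K)).2 (fun a ha b hb => ?_) hg
    change matActHom k n ⁅a, b⁆ f = f
    have hf' := apply_mem_commFixed hf ((⟨b, hb⟩ * ⟨a, ha⟩ : ↥W)⁻¹)
    have h4 : matActHom k n (a * b) (matActHom k n (b * a)⁻¹ f) =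
        matActHom k n (b * a) (matActHom k n (b * a)⁻¹ f) := hf' ⟨a, ha⟩ ⟨b, hb⟩
    rw [map_apply_map_inv, ← map_mul_apply] at h4
    rwa [show ⁅a, b⁆ = a * b * (b * a)⁻¹ by
      rw [commutatorElement_def, mul_inv_rev, mul_assoc (a * b)]]

end Matrices

section Assembly

theorem exists_kummer_presentation [CharZero k] {n : ℕ} {Γ : Type} [Group Γ] [Finite Γ]
    {ρ : Γ →* (MvPolynomial (Fin n) k →ₐ[k] MvPolynomial (Fin n) k)}
    (hρ : ∀ g i, (ρ g (X i)).IsHomogeneous 1)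
    {S : Set Γ} (hS : Subgroup.closure S = ⊤)
    (hα : ∀ s ∈ S, ∃ α : MvPolynomial (Fin n) k, α.IsHomogeneous 1 ∧ α ≠ 0 ∧ ∀ f, α ∣ ρ s f - f) :
    ∃ (ι : Type) (_ : Fintype ι) (q : Fin n ⊕ ι → MvPolynomial (Fin n) k)
      (χ : Fin n ⊕ ι → Γ →* kˣ) (e : ι → ℕ) (D : ι → MvPolynomial (Fin n) k),
      (∀ j, constantCoeff (q j) = 0) ∧ (∀ j, IsSemiInv ρ (χ j) (q j)) ∧ (∀ i, χ (Sum.inl i) = 1) ∧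
      (∀ c g, χ (Sum.inr c) g ^ e c = 1) ∧
      RingHom.ker (aeval q : MvPolynomial (Fin n ⊕ ι) k →ₐ[k] _) =
        Ideal.span (Set.range (kummerRel e D)) ∧
      Algebra.adjoin k (Set.range q) = commFixed ρ := by
  cases nonempty_fintype Γ
  choose! α hα1 hα0 hdvd using hα
  obtain ⟨F, hF0, hFind, hF⟩ := exists_basic_invariants hρ hS hα1 hα0 hdvd
  obtain ⟨ι, hι, y, θ, hy0, hyc, hy, hθ, hydvd⟩ :=
    exists_orbit_semiInvariants hρ hS hα1 hα0 hdvd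
  have hFfix : ∀ i, F i ∈ fixedAlg ρ := fun i => hF ▸ Algebra.subset_adjoin ⟨i, rfl⟩
  have hpow : ∀ c g, θ c g ^ orderOf (θ c) = 1 := fun c g => by
    rw [← MonoidHom.pow_apply, pow_orderOf_eq_one, MonoidHom.one_apply]
  have hD : ∀ c, ∃ D : MvPolynomial (Fin n) k, aeval F D = y c ^ orderOf (θ c) := fun c => by
    have h : y c ^ orderOf (θ c) ∈ fixedAlg ρ := fun g => by
      rw [map_pow, hy c g, smul_pow, ← Units.val_pow_eq_pow_val, hpow, Units.val_one, one_smul]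
    rw [← hF, Algebra.adjoin_range_eq_range_aeval] at h
    exact h
  choose D hD using hD
  refine ⟨ι, hι, Sum.elim F y, Sum.elim (fun _ => 1) θ, fun c => orderOf (θ c), D, ?_, ?_,
    fun _ => rfl, hpow, ?_, adjoin_sumElim_eq_commFixed hρ hS hα1 hα0 hdvd hF hy0 hyc hy hydvd⟩
  · rintro (i | c)
    exacts [hF0 i, hyc c]
  · rintro (i | c)
    exacts [isSemiInv_one_iff.2 (hFfix i), hy c]
  · refine ker_aeval_sumElim hFind hFfix hy0 hy hθ (fun c z hz => ?_) (fun c => ?_) hD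
    · rw [orderOf_dvd_iff_zpow_eq_one]
      exact MonoidHom.ext fun g => by rw [MonoidHom.zpow_apply, hz, MonoidHom.one_apply]
    · refine orderOf_pos_iff.2 (isOfFinOrder_iff_pow_eq_one.2 ⟨Nat.card Γ, Nat.card_pos, ?_⟩)
      exact MonoidHom.ext fun g => by
        rw [MonoidHom.pow_apply, ← map_pow, pow_card_eq_one', map_one, MonoidHom.one_apply]

theorem aeval_kummerRel_mem_fixedAlg {Γ : Type*} [Group Γ] {A : Type*} [CommRing A] [Algebra k A]
    {τ : Γ →* (A →ₐ[k] A)} {σ ι : Type} {t : σ ⊕ ι → A} {χ : σ ⊕ ι → Γ →* kˣ}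
    (ht : ∀ j, IsSemiInv τ (χ j) (t j)) (hσ : ∀ i, χ (Sum.inl i) = 1) {e : ι → ℕ}
    (he : ∀ c g, χ (Sum.inr c) g ^ e c = 1) (D : ι → MvPolynomial σ k) (c : ι) :
    aeval t (kummerRel e D c) ∈ fixedAlg τ := by
  rw [kummerRel, map_sub, map_pow, aeval_X, aeval_rename]
  refine sub_mem (fun g => ?_) (fun g => ?_)
  · rw [map_pow, ht _ g, smul_pow, ← Units.val_pow_eq_pow_val, he, Units.val_one, one_smul]
  · rw [← AlgHom.comp_apply, comp_aeval]
    congr 2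
    funext i
    exact isSemiInv_one_iff.1 (hσ i ▸ ht (Sum.inl i)) g

theorem polyAct_X {m : ℕ} (M : Fin m → Fin m → k) (i : Fin m) :
    polyAct M (X i) = ∑ j, M i j • X j :=
  aeval_X _ _

theorem aeval_polyAct {n m : ℕ} {p : Fin m → MvPolynomial (Fin n) k} {M : Fin m → Fin m → k}
    {π : MvPolynomial (Fin n) k →ₐ[k] MvPolynomial (Fin n) k}
    (h : ∀ i, π (p i) = ∑ j, M i j • p j) (f : MvPolynomial (Fin m) k) :
    aeval p (polyAct M f) = π (aeval p f) := by
  suffices h' : (aeval p).comp (polyAct M) = π.comp (aeval p) from DFunLike.congr_fun h' f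
  refine algHom_ext fun i => ?_
  simp [polyAct_X, h]

/-- The action on `k[X_1, …, X_m]` induced by an action on the span of linearly independent
elements. -/
theorem exists_polyAct_monoidHom {n m : ℕ} {Γ : Type*} [Group Γ]
    {ρ : Γ →* (MvPolynomial (Fin n) k →ₐ[k] MvPolynomial (Fin n) k)}
    {p : Fin m → MvPolynomial (Fin n) k} (hp : LinearIndependent k p)
    {c : Γ → Fin m → Fin m → k} (hc : ∀ w i, ρ w (p i) = ∑ j, c w i j • p j) :
    ∃ τ : Γ →* (MvPolynomial (Fin m) k →ₐ[k] MvPolynomial (Fin m) k),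
      ∀ w, τ w = polyAct (c w) := by
  have hinj : ∀ a b : Fin m → k, ∑ j, a j • p j = ∑ j, b j • p j → a = b := fun a b h => by
    have h1 := Fintype.linearIndependent_iff.1 hp (a - b)
      (by simp only [Pi.sub_apply, sub_smul, Finset.sum_sub_distrib, h, sub_self])
    funext j
    exact sub_eq_zero.1 (h1 j)
  have hone : ∀ i, c 1 i = Pi.single i 1 := fun i => hinj _ _ (by
    rw [← hc, map_one, AlgHom.one_apply]
    simp [Pi.single_apply])
  have hmul : ∀ v w i, c (v * w) i = fun l => ∑ j, c w i j * c v j l := fun v w i => hinj _ _ (by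
    rw [← hc, map_mul, AlgHom.mul_apply, hc w, map_sum]
    simp only [map_smul, hc v, Finset.smul_sum, Finset.sum_smul, smul_smul]
    exact Finset.sum_comm)
  refine ⟨{ toFun := fun w => polyAct (c w), map_one' := ?_, map_mul' := fun v w => ?_ },
    fun _ => rfl⟩
  · refine algHom_ext fun i => ?_
    rw [polyAct_X, hone]
    simp [Pi.single_apply]
  · refine algHom_ext fun i => ?_
    rw [polyAct_X, hmul, AlgHom.mul_apply, polyAct_X, map_sum]
    simp only [map_smul, polyAct_X, Finset.smul_sum, Finset.sum_smul, smul_smul]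
    exact Finset.sum_comm

theorem trivialConormal_of_presentation {n m : ℕ}
    {Wt : Subgroup (Matrix.GeneralLinearGroup (Fin n) k)}
    {p : Fin m → MvPolynomial (Fin n) k} {c : ↥Wt → Fin m → Fin m → k}
    (hc : ∀ w i, subgroupAct Wt w (p i) = ∑ j, c w i j • p j)
    {κ : Type*} {R : κ → MvPolynomial (Fin m) k} (hR : ∀ l, R l ∈ relIdeal p)
    (hfix : ∀ l w, polyAct (c w) (R l) = R l)
    (hI : ∀ f ∈ relIdeal p, ∃ g ∈ Ideal.span (Set.range R), f - g ∈ idealPlus k m * relIdeal p) :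
    TrivialConormal Wt p c := by
  intro w f hf
  have hcc : ∀ a, constantCoeff (polyAct (c w) a) = constantCoeff a := fun a =>
    constantCoeff_aeval_of_forall (fun i => by simp) a
  have hrel : ∀ a ∈ relIdeal p, polyAct (c w) a ∈ relIdeal p := fun a ha => by
    rw [relIdeal, RingHom.mem_ker] at ha ⊢
    rw [aeval_polyAct (hc w), ha, map_zero]
  have hstab : idealPlus k m * relIdeal p ≤
      (idealPlus k m * relIdeal p).comap (polyAct (c w)) := by
    refine Ideal.mul_le.2 fun a ha b hb => ?_
    rw [Ideal.mem_comap, map_mul]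
    refine Ideal.mul_mem_mul ?_ (hrel b hb)
    rw [mem_idealPlus_iff] at ha ⊢
    rw [hcc, ha]
  have hspan : ∀ g ∈ Ideal.span (Set.range R), g ∈ relIdeal p ∧
      polyAct (c w) g - g ∈ idealPlus k m * relIdeal p := fun g hg => by
    induction hg using Submodule.span_induction with
    | mem x hx =>
      obtain ⟨l, rfl⟩ := hx
      exact ⟨hR l, by rw [hfix, sub_self]; exact zero_mem _⟩
    | zero => simp
    | add x y _ _ hx hy =>
      exact ⟨add_mem hx.1 hy.1, by rw [map_add, add_sub_add_comm]; exact add_mem hx.2 hy.2⟩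
    | smul a x _ hx =>
      refine ⟨Ideal.mul_mem_left _ a hx.1, ?_⟩
      rw [smul_eq_mul, map_mul, show polyAct (c w) a * polyAct (c w) x - a * x =
        polyAct (c w) a * (polyAct (c w) x - x) + (polyAct (c w) a - a) * x by ring]
      refine add_mem (Ideal.mul_mem_left _ _ hx.2) (Ideal.mul_mem_mul ?_ hx.1)
      rw [mem_idealPlus_iff, map_sub, hcc, sub_self]
  obtain ⟨g, hg, hfg⟩ := hI f hf
  have h1 : polyAct (c w) (f - g) ∈ idealPlus k m * relIdeal p := hstab hfg
  have h2 := add_mem (sub_mem h1 hfg) (hspan g hg).2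
  rwa [map_sub, show polyAct (c w) f - polyAct (c w) g - (f - g) + (polyAct (c w) g - g) =
    polyAct (c w) f - f by ring] at h2

theorem QuotSetup.linearIndependent {n m : ℕ}
    {Wt G : Subgroup (Matrix.GeneralLinearGroup (Fin n) k)}
    {p : Fin m → MvPolynomial (Fin n) k} {d : Fin m → ℕ} {c : ↥Wt → Fin m → Fin m → k}
    (h : QuotSetup Wt G p d c) : LinearIndependent k p :=
  Fintype.linearIndependent_iff.2 fun a ha => congrFun (h.minimal a (ha ▸ zero_mem _))

theorem QuotSetup.constantCoeff_eq_zero {n m : ℕ}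
    {Wt G : Subgroup (Matrix.GeneralLinearGroup (Fin n) k)}
    {p : Fin m → MvPolynomial (Fin n) k} {d : Fin m → ℕ} {c : ↥Wt → Fin m → Fin m → k}
    (h : QuotSetup Wt G p d c) (i : Fin m) : constantCoeff (p i) = 0 :=
  constantCoeff_eq_zero_of_isWeightedHomogeneous (h.homog i) (h.dpos i).ne'

theorem aeval_sub_sum_linCoeff_mem_sqSpan {n m : ℕ}
    {G : Subgroup (Matrix.GeneralLinearGroup (Fin n) k)} {p : Fin m → MvPolynomial (Fin n) k}
    (hp : ∀ i, p i ∈ invariants G) (hp0 : ∀ i, constantCoeff (p i) = 0)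
    (f : MvPolynomial (Fin m) k) :
    aeval p f - C (constantCoeff f) - ∑ i, linCoeff i f • p i ∈ sqSpan G := by
  induction f using MvPolynomial.induction_on with
  | C a => simp [linCoeff_C, algebraMap_eq]
  | add f g hf hg =>
    convert add_mem hf hg using 1
    simp only [map_add, add_smul, Finset.sum_add_distrib]
    ring
  | mul_X f i _ =>
    have h1 : ∑ j, linCoeff j (f * X i) • p j = C (constantCoeff f) * p i := by
      simp [linCoeff_mul, linCoeff_X, smul_eq_C_mul]
    have h2 : aeval p (f * X i) - C (constantCoeff (f * X i)) - ∑ j, linCoeff j (f * X i) • p j =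
        (aeval p f - C (constantCoeff f)) * p i := by
      rw [h1, map_mul, aeval_X, map_mul, constantCoeff_X, mul_zero, C_0, sub_zero, sub_mul]
    rw [h2]
    refine Submodule.subset_span ⟨_, sub_mem ?_ ?_, p i, hp i, ?_, hp0 i, rfl⟩
    · have h3 : Algebra.adjoin k (Set.range p) ≤ invariants G :=
        Algebra.adjoin_le (Set.range_subset_iff.2 hp)
      rw [Algebra.adjoin_range_eq_range_aeval] at h3
      exact h3 ⟨f, rfl⟩
    · exact (invariants G).algebraMap_mem _
    · rw [map_sub, constantCoeff_aeval_of_forall hp0, constantCoeff_C, sub_self]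

theorem QuotSetup.linCoeff_eq_zero {n m : ℕ}
    {Wt G : Subgroup (Matrix.GeneralLinearGroup (Fin n) k)}
    {p : Fin m → MvPolynomial (Fin n) k} {d : Fin m → ℕ} {c : ↥Wt → Fin m → Fin m → k}
    (h : QuotSetup Wt G p d c) {f : MvPolynomial (Fin m) k} (hf : f ∈ relIdeal p) (i : Fin m) :
    linCoeff i f = 0 := by
  have hp : ∀ i, p i ∈ invariants G := fun i => h.gen ▸ Algebra.subset_adjoin ⟨i, rfl⟩
  have h0 : aeval p f = 0 := hf
  have h1 := aeval_sub_sum_linCoeff_mem_sqSpan hp h.constantCoeff_eq_zero f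
  rw [← constantCoeff_aeval_of_forall h.constantCoeff_eq_zero f, h0, map_zero, C_0, sub_zero,
    zero_sub, neg_mem_iff] at h1
  exact congrFun (h.minimal _ h1) i

end Assembly

/-- the derived subgroup `[Wt, Wt]` is a good normal subgroup of `Wt`. -/
theorem statement16 [CharZero k] {n m : ℕ}
    (Wt G : Subgroup (Matrix.GeneralLinearGroup (Fin n) k))
    (p : Fin m → MvPolynomial (Fin n) k) (d : Fin m → ℕ)
    (c : ↥Wt → Fin m → Fin m → k)
    (hsetup : QuotSetup Wt G p d c)
    (hG : G = ⁅Wt, Wt⁆) :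
    IsGoodQuot Wt p c := by
  have : Finite ↥Wt := hsetup.finite.to_subtype
  cases nonempty_fintype ↥Wt
  obtain ⟨ι, _, q, χ, e, D, hq0, hq, hχ, he, hker, hadj⟩ :=
    exists_kummer_presentation (ρ := subgroupAct Wt)
      (fun g i => isHomogeneous_matAct_X _ i) hsetup.reflGroup.closure_eq_top
      fun s hs => IsReflection.exists_dvd_sub hs
  have hgen : Algebra.adjoin k (Set.range p) = Algebra.adjoin k (Set.range q) := by
    rw [hsetup.gen, hadj, hG, invariants_commutator]
  have hpq : ∀ i, p i ∈ (aeval q : MvPolynomial (Fin n ⊕ ι) k →ₐ[k] _).range := fun i => by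
    rw [← Algebra.adjoin_range_eq_range_aeval, ← hgen]
    exact Algebra.subset_adjoin ⟨i, rfl⟩
  have hqp : ∀ j, ∃ f, aeval p f = q j := fun j => by
    have h : q j ∈ (aeval p : MvPolynomial (Fin m) k →ₐ[k] _).range := by
      rw [← Algebra.adjoin_range_eq_range_aeval, hgen]
      exact Algebra.subset_adjoin ⟨j, rfl⟩
    exact h
  choose u hu using hqp
  have hc : ∀ w i, subgroupAct Wt w (p i) = ∑ j, c w i j • p j := hsetup.equivar
  obtain ⟨τ, hτ⟩ := exists_polyAct_monoidHom hsetup.linearIndependent hc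
  have ht : ∀ j, aeval p (charAvg τ (χ j) (u j)) = q j := fun j => by
    rw [charAvg_map (ρ := subgroupAct Wt) (χ j) (aeval p)
      (fun w a => by rw [hτ]; exact aeval_polyAct (hc w) a), hu, (hq j).charAvg_eq]
  refine ⟨isCompleteIntersection_of_presentation hsetup.dpos hsetup.homog hq0 hker hpq ht
    (by simp), ?_⟩
  refine trivialConormal_of_presentation hc
    (R := fun l => aeval (fun j => charAvg τ (χ j) (u j)) (kummerRel e D l))
    (fun l => ?_) (fun l w => ?_) fun f hf => ?_
  · have hl : aeval q (kummerRel e D l) = 0 := by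
      rw [← RingHom.mem_ker, hker]
      exact Ideal.subset_span ⟨l, rfl⟩
    rw [relIdeal, RingHom.mem_ker, ← AlgHom.comp_apply, comp_aeval, ← hl]
    exact congrArg (fun v => aeval v (kummerRel e D l)) (funext ht)
  · rw [← hτ]
    exact aeval_kummerRel_mem_fixedAlg (fun j => isSemiInv_charAvg τ (χ j) (u j)) hχ he D l w
  · exact mem_span_sup_of_mem_relIdeal hsetup.constantCoeff_eq_zero
      (fun f hf i => hsetup.linCoeff_eq_zero hf i) hker hpq ht hf

end ReflQuot
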